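/- arXiv:1806.01987 — 2 statements merged into one kernel-verified Lean document; each statement's English description precedes it below -/
import Mathlib

section
/- Let w(x₁,x₂) = -|x₁|^{4/3} on ℝ², so that |Dw(x)| = (4/3)|x₁|^{1/3} for x₁ ≠ 0. Fix α ∈ (0, 3/2]. Then |Dw|^α = (4/3)^α |x₁|^{α/3} belongs to W^{1,1}_loc(ℝ²) with weak gradient D|Dw|^α(x) = ( (α/3)(4/3)^α |x₁|^{(α-3)/3} sgn(x₁), 0 ) for x₁ ≠ 0, but |D|Dw|^α| does not belong to L^{3/(3-α)}(B(0,1)); consequently |Dw|^α ∉ W^{1,3/(3-α)}_loc(ℝ²), i.e. there is no weak gradient of |Dw|^α lying in L^{3/(3-α)}_loc(ℝ²;ℝ²). -/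
open MeasureTheory Metric
open scoped ENNReal RealInnerProductSpace BigOperators

noncomputable section

abbrev E2 : Type := EuclideanSpace ℝ (Fin 2)

/-- Partial derivative in the `i`-th coordinate direction. -/
def pd (i : Fin 2) (φ : E2 → ℝ) (x : E2) : ℝ :=
  fderiv ℝ φ x (EuclideanSpace.single i 1)

/-- Second partial derivative. -/
def pd2 (i j : Fin 2) (φ : E2 → ℝ) (x : E2) : ℝ :=
  pd i (pd j φ) x

/-- The ∞-Laplacian `Δ_∞ φ = Σ_{i,j} φ_i φ_j φ_{ij}`. -/
def infLap (φ : E2 → ℝ) (x : E2) : ℝ :=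
  ∑ i : Fin 2, ∑ j : Fin 2, pd i φ x * pd j φ x * pd2 i j φ x

/-- The ordinary Laplacian. -/
def lap (φ : E2 → ℝ) (x : E2) : ℝ := pd2 0 0 φ x + pd2 1 1 φ x

/-- `|Dφ|²`. -/
def gradSq (φ : E2 → ℝ) (x : E2) : ℝ := ∑ i : Fin 2, (pd i φ x) ^ 2

/-- `|D²φ Dφ|²`. -/
def hessGradSq (φ : E2 → ℝ) (x : E2) : ℝ :=
  ∑ i : Fin 2, (∑ j : Fin 2, pd2 i j φ x * pd j φ x) ^ 2

/-- Viscosity solution of `-Δ_∞ u = f` on `Ω`. -/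
def IsViscositySol (Ω : Set E2) (f u : E2 → ℝ) : Prop :=
  ∀ φ : E2 → ℝ, ContDiff ℝ 2 φ →
    (∀ x₀ ∈ Ω, IsLocalMaxOn (fun y => u y - φ y) Ω x₀ → -infLap φ x₀ ≤ f x₀) ∧
    (∀ x₀ ∈ Ω, IsLocalMinOn (fun y => u y - φ y) Ω x₀ → f x₀ ≤ -infLap φ x₀)

/-- `G` is a weak gradient of `v` on `Ω`. -/
def HasWeakGradOn (v : E2 → ℝ) (G : E2 → E2) (Ω : Set E2) : Prop :=
  LocallyIntegrableOn v Ω volume ∧ LocallyIntegrableOn (fun x => ‖G x‖) Ω volume ∧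
    ∀ φ : E2 → ℝ, ContDiff ℝ (⊤ : ℕ∞) φ → HasCompactSupport φ → tsupport φ ⊆ Ω →
      ∀ i : Fin 2, ∫ x in Ω, v x * pd i φ x = - ∫ x in Ω, G x i * φ x

/-- `G ∈ L^p_loc(Ω; ℝ²)`. -/
def MemLpLocOn (G : E2 → E2) (p : ℝ) (Ω : Set E2) : Prop :=
  ∀ K : Set E2, K ⊆ Ω → IsCompact K → IntegrableOn (fun x => ‖G x‖ ^ p) K volume

/-- `v ∈ W^{1,p}_loc(Ω)`: there is a weak gradient of `v` lying in `L^p_loc(Ω;ℝ²)`. -/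
def MemW1pLoc (v : E2 → ℝ) (p : ℝ) (Ω : Set E2) : Prop :=
  ∃ G : E2 → E2, HasWeakGradOn v G Ω ∧ MemLpLocOn G p Ω

/-- Divergence of a vector field. -/
def divg (Φ : E2 → E2) (x : E2) : ℝ := ∑ i : Fin 2, pd i (fun y => Φ y i) x

/-- The admissible pairings defining the BV norm of `f` on `U`. -/
def bvPairings (f : E2 → ℝ) (U : Set E2) : Set ℝ :=
  { r | ∃ Φ : E2 → E2, ContDiff ℝ 1 Φ ∧ HasCompactSupport Φ ∧ tsupport Φ ⊆ U ∧
      (∀ x, ‖Φ x‖ ≤ 1) ∧ r = ∫ x in U, f x * divg Φ x }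

/-- `‖f‖_{BV(U)}`. -/
def bvNorm (f : E2 → ℝ) (U : Set E2) : ℝ := sSup (bvPairings f U)

/-- `f ∈ BV_loc(Ω)`. -/
def BVloc (f : E2 → ℝ) (Ω : Set E2) : Prop :=
  ∀ U : Set E2, IsOpen U → IsCompact (closure U) → closure U ⊆ Ω →
    BddAbove (bvPairings f U)

/-- `sup_s |h|`. -/
def supAbsOn (h : E2 → ℝ) (s : Set E2) : ℝ := sSup ((fun y => |h y|) '' s)

/-- The claimed weak gradient of `|Dw|^α` for `w(x₁,x₂) = -|x₁|^{4/3}`, namely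
`x ↦ ((α/3)(4/3)^α |x₁|^{(α-3)/3} sgn(x₁), 0)`. -/
def wGrad (α : ℝ) (x : E2) : E2 :=
  EuclideanSpace.single 0
    ((α / 3) * ((4 : ℝ) / 3) ^ α * |x 0| ^ ((α - 3) / 3) * Real.sign (x 0))

/-- The coordinate identification of `E2` with `ℝ × ℝ`. -/
def coordEquiv : E2 ≃ᵐ ℝ × ℝ :=
  (MeasurableEquiv.toLp 2 (Fin 2 → ℝ)).symm.trans MeasurableEquiv.finTwoArrow

lemma coordEquiv_apply (x : E2) : coordEquiv x = (x 0, x 1) := rfl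

lemma measurePreserving_coordEquiv : MeasurePreserving coordEquiv :=
  (EuclideanSpace.volume_preserving_symm_measurableEquiv_toLp (Fin 2)).trans
    (volume_preserving_finTwoArrow ℝ)

/-- The product `s × t` viewed as a subset of `E2`. -/
def box (s t : Set ℝ) : Set E2 := {x | x 0 ∈ s ∧ x 1 ∈ t}

lemma integrableOn_box_comp_coord_iff {f : ℝ → ℝ} {s t : Set ℝ}
    (ht : volume t ≠ 0) (ht' : volume t ≠ ⊤) :
    IntegrableOn (fun x : E2 => f (x 0)) (box s t) ↔ IntegrableOn f s := by
  have : Fact (volume t < ⊤) := ⟨ht'.lt_top⟩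
  have hbox : box s t = coordEquiv ⁻¹' (s ×ˢ t) := by
    ext x; simp [box, coordEquiv_apply]
  have h1 := measurePreserving_coordEquiv.integrableOn_comp_preimage
    coordEquiv.measurableEmbedding (f := fun z : ℝ × ℝ => f z.1) (s := s ×ˢ t)
  have h2 : IntegrableOn (fun z : ℝ × ℝ => f z.1) (s ×ˢ t) ↔ IntegrableOn f s := by
    rw [IntegrableOn, Measure.volume_eq_prod, ← Measure.prod_restrict]
    exact Integrable.comp_fst_iff (by simpa using ht)
  rw [hbox]
  exact h1.trans h2

lemma locallyIntegrable_comp_coord {f : ℝ → ℝ} (hf : LocallyIntegrable f) :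
    LocallyIntegrable (fun x : E2 => f (x 0)) := by
  rw [locallyIntegrable_iff]
  intro K hK
  obtain ⟨R, hR, hKR⟩ := hK.isBounded.exists_pos_norm_le
  have hbox : IntegrableOn (fun x : E2 => f (x 0)) (box (Set.Icc (-R) R) (Set.Icc (-R) R)) := by
    rw [integrableOn_box_comp_coord_iff]
    · exact hf.integrableOn_isCompact isCompact_Icc
    · simp [hR]
    · simp
  refine hbox.mono_set fun x hx => ?_
  have h (i : Fin 2) : x i ∈ Set.Icc (-R) R :=
    abs_le.1 ((PiLp.norm_apply_le x i).trans (hKR x hx))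
  exact ⟨h 0, h 1⟩

lemma locallyIntegrable_abs_rpow {s : ℝ} (hs : -1 < s) :
    LocallyIntegrable (fun t : ℝ => |t| ^ s) := by
  refine locallyIntegrable_of_norm_le_rpow (C := 1) (α := -s) (by simp) (by simp; linarith) ?_
    (Measurable.aestronglyMeasurable (by fun_prop))
  refine Filter.Eventually.of_forall fun t => ?_
  simp [abs_of_nonneg (Real.rpow_nonneg (abs_nonneg t) s)]

lemma not_integrableOn_abs_inv_coord :
    ¬ IntegrableOn (fun x : E2 => |x 0|⁻¹) (ball (0 : E2) 1 ∩ {x | 0 < x 0}) := by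
  intro h
  have hsub : box (Set.Ioo 0 (1 / 2)) (Set.Ioo 0 (1 / 2)) ⊆
      ball (0 : E2) 1 ∩ {x | 0 < x 0} := by
    rintro x ⟨⟨h1, h2⟩, h3, h4⟩
    refine ⟨?_, h1⟩
    rw [mem_ball_zero_iff, EuclideanSpace.norm_eq, Real.sqrt_lt' one_pos]
    simp only [Real.norm_eq_abs, sq_abs, Fin.sum_univ_two]
    nlinarith
  have h' := (integrableOn_box_comp_coord_iff (f := fun t => |t|⁻¹) (by simp) (by simp)).1
    (h.mono_set hsub)
  have h2 : IntegrableOn (fun t : ℝ => t ^ (-1 : ℝ)) (Set.Ioo 0 (1 / 2)) := by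
    refine h'.congr_fun (fun t ht => ?_) measurableSet_Ioo
    simp [abs_of_pos ht.1, Real.rpow_neg_one]
  rw [intervalIntegral.integrableOn_Ioo_rpow_iff (by norm_num)] at h2
  exact lt_irrefl _ h2

lemma wGrad_apply_one (α : ℝ) (x : E2) : wGrad α x 1 = 0 := by
  simp [wGrad]

lemma wGrad_apply_zero (α : ℝ) (x : E2) : wGrad α x 0 =
    (α / 3) * ((4 : ℝ) / 3) ^ α * |x 0| ^ ((α - 3) / 3) * Real.sign (x 0) := by
  simp [wGrad]

lemma norm_wGrad (α : ℝ) (x : E2) : ‖wGrad α x‖ = |wGrad α x 0| := by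
  rw [wGrad_apply_zero, wGrad, PiLp.norm_single, Real.norm_eq_abs]

lemma wGrad_apply_zero_of_pos (α : ℝ) {x : E2} (hx : 0 < x 0) : wGrad α x 0 =
    (α / 3) * ((4 : ℝ) / 3) ^ α * |x 0| ^ ((α - 3) / 3) := by
  rw [wGrad_apply_zero, Real.sign_of_pos hx, mul_one]

lemma measurable_sign : Measurable Real.sign := by
  unfold Real.sign
  refine Measurable.ite measurableSet_Iio measurable_const ?_
  exact Measurable.ite measurableSet_Ioi measurable_const measurable_const

lemma measurable_wGrad_apply_zero (α : ℝ) : Measurable (fun x : E2 => wGrad α x 0) := by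
  simp only [wGrad_apply_zero]
  have h := measurable_sign.comp (g := Real.sign) (f := fun x : E2 => x 0) (by fun_prop)
  have h2 : Measurable (fun x : E2 => |x 0| ^ ((α - 3) / 3)) := by fun_prop
  exact (h2.const_mul _).mul h

lemma abs_wGrad_apply_zero_le {α : ℝ} (hα0 : 0 < α) (x : E2) :
    |wGrad α x 0| ≤ (α / 3) * ((4 : ℝ) / 3) ^ α * |x 0| ^ ((α - 3) / 3) := by
  rw [wGrad_apply_zero, abs_mul, abs_of_nonneg (by positivity)]
  refine mul_le_of_le_one_right (by positivity) ?_
  rcases Real.sign_apply_eq (x 0) with h | h | h <;> simp [h]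

lemma locallyIntegrable_wGrad_apply_zero {α : ℝ} (hα0 : 0 < α) :
    LocallyIntegrable (fun x : E2 => wGrad α x 0) := by
  have h := (locallyIntegrable_comp_coord
    (locallyIntegrable_abs_rpow (s := (α - 3) / 3) (by linarith))).smul
      ((α / 3) * ((4 : ℝ) / 3) ^ α)
  refine h.mono (measurable_wGrad_apply_zero α).aestronglyMeasurable
    (Filter.Eventually.of_forall fun x => ?_)
  refine (abs_wGrad_apply_zero_le hα0 x).trans ?_
  exact le_abs_self _

lemma norm_wGrad_rpow_of_pos {α : ℝ} (hα0 : 0 < α) (hα1 : α ≤ 3 / 2) {x : E2} (hx : 0 < x 0) :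
    ‖wGrad α x‖ ^ (3 / (3 - α)) =
      ((α / 3) * ((4 : ℝ) / 3) ^ α) ^ (3 / (3 - α)) * |x 0|⁻¹ := by
  rw [norm_wGrad, wGrad_apply_zero_of_pos α hx, abs_of_nonneg (by positivity),
    Real.mul_rpow (by positivity) (by positivity), ← Real.rpow_mul (abs_nonneg _)]
  have : (α - 3) / 3 * (3 / (3 - α)) = -1 := by
    have : 3 - α ≠ 0 := by linarith
    field_simp
    ring
  rw [this, Real.rpow_neg_one]

lemma not_integrableOn_norm_wGrad_rpow {α : ℝ} (hα0 : 0 < α) (hα1 : α ≤ 3 / 2) :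
    ¬ IntegrableOn (fun x : E2 => ‖wGrad α x‖ ^ (3 / (3 - α)))
      (ball (0 : E2) 1 ∩ {x | 0 < x 0}) := by
  intro h
  refine not_integrableOn_abs_inv_coord ?_
  have hC : 0 < ((α / 3) * ((4 : ℝ) / 3) ^ α) ^ (3 / (3 - α)) := by positivity
  refine (IntegrableOn.congr_fun (h.const_mul (((α / 3) * ((4 : ℝ) / 3) ^ α) ^ (3 / (3 - α)))⁻¹)
    (fun x hx => ?_) ?_)
  · simp only [norm_wGrad_rpow_of_pos hα0 hα1 hx.2]
    field_simp
  · exact measurableSet_ball.inter (measurableSet_lt measurable_const (by fun_prop))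

/-- The smooth regularization `(4/3)^α (x₁² + ε²)^{α/6}` of `(4/3)^α |x₁|^{α/3}`. -/
def regPow (α ε : ℝ) (x : E2) : ℝ := ((4 : ℝ) / 3) ^ α * (x 0 ^ 2 + ε ^ 2) ^ (α / 6)

/-- The derivative of `regPow α ε` in the direction of the first coordinate. -/
def regPowDeriv (α ε : ℝ) (x : E2) : ℝ :=
  (α / 3) * ((4 : ℝ) / 3) ^ α * (x 0 * (x 0 ^ 2 + ε ^ 2) ^ (α / 6 - 1))

lemma continuous_regPow {α ε : ℝ} (hε : 0 < ε) : Continuous (regPow α ε) := by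
  unfold regPow
  refine continuous_const.mul (Continuous.rpow_const (by fun_prop) fun x => Or.inl ?_)
  positivity

lemma continuous_regPowDeriv {α ε : ℝ} (hε : 0 < ε) : Continuous (regPowDeriv α ε) := by
  unfold regPowDeriv
  refine continuous_const.mul (Continuous.mul (by fun_prop)
    (Continuous.rpow_const (by fun_prop) fun x => Or.inl ?_))
  positivity

lemma hasFDerivAt_regPow {α ε : ℝ} (hε : 0 < ε) (x : E2) :
    HasFDerivAt (regPow α ε) (regPowDeriv α ε x • (EuclideanSpace.proj 0 : E2 →L[ℝ] ℝ)) x := by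
  have h1 : HasDerivAt (fun t : ℝ => ((4 : ℝ) / 3) ^ α * (t ^ 2 + ε ^ 2) ^ (α / 6))
      (regPowDeriv α ε x) (x 0) := by
    have h := ((((hasDerivAt_id (x 0)).pow 2).add_const (ε ^ 2)).rpow_const (p := α / 6)
      (Or.inl (by simp only [Pi.pow_apply, id]; positivity))).const_mul (((4 : ℝ) / 3) ^ α)
    refine h.congr_deriv ?_
    simp only [regPowDeriv, Pi.pow_apply, id, Nat.cast_ofNat]
    ring
  exact HasDerivAt.comp_hasFDerivAt (f := fun y : E2 => y 0) x h1
    (EuclideanSpace.proj 0 : E2 →L[ℝ] ℝ).hasFDerivAt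

lemma abs_regPowDeriv_le {α ε : ℝ} (hα1 : α ≤ 3 / 2) (x : E2) :
    |regPowDeriv α ε x| ≤ |wGrad α x 0| := by
  rcases eq_or_ne (x 0) 0 with h0 | h0
  · simp [regPowDeriv, h0]
  have hs : |Real.sign (x 0)| = 1 := by
    rcases Real.sign_apply_eq_of_ne_zero _ h0 with h | h <;> simp [h]
  rw [wGrad_apply_zero, regPowDeriv, abs_mul, abs_mul _ (Real.sign (x 0)), hs, mul_one,
    abs_mul _ (|x 0| ^ ((α - 3) / 3)), abs_mul (x 0)]
  refine mul_le_mul_of_nonneg_left ?_ (abs_nonneg _)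
  rw [abs_of_nonneg (a := (x 0 ^ 2 + ε ^ 2) ^ (α / 6 - 1)) (by positivity),
    abs_of_nonneg (a := |x 0| ^ ((α - 3) / 3)) (by positivity)]
  have hx : 0 < |x 0| := abs_pos.2 h0
  calc |x 0| * (x 0 ^ 2 + ε ^ 2) ^ (α / 6 - 1)
      ≤ |x 0| * (|x 0| ^ 2) ^ (α / 6 - 1) := by
        refine mul_le_mul_of_nonneg_left ?_ hx.le
        refine Real.rpow_le_rpow_of_nonpos (by positivity) ?_ (by linarith)
        rw [sq_abs]
        nlinarith [sq_nonneg ε]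
    _ = |x 0| ^ ((α - 3) / 3) := by
        rw [← Real.rpow_natCast, ← Real.rpow_mul hx.le, ← Real.rpow_one_add' hx.le]
        · congr 1
          push_cast
          ring
        · push_cast
          intro h
          linarith

lemma tendsto_regPow {α : ℝ} (hα0 : 0 < α) (x : E2) :
    Filter.Tendsto (fun n : ℕ => regPow α (1 / ((n : ℝ) + 1)) x) Filter.atTop
      (nhds (((4 : ℝ) / 3) ^ α * |x 0| ^ (α / 3))) := by
  have h : Filter.Tendsto (fun n : ℕ => x 0 ^ 2 + (1 / ((n : ℝ) + 1)) ^ 2) Filter.atTop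
      (nhds (x 0 ^ 2)) := by
    simpa using (tendsto_one_div_add_atTop_nhds_zero_nat (𝕜 := ℝ)).pow 2 |>.const_add (x 0 ^ 2)
  have h2 := (h.rpow_const (p := α / 6) (Or.inr (by positivity))).const_mul (((4 : ℝ) / 3) ^ α)
  have h3 : (x 0 ^ 2) ^ (α / 6) = |x 0| ^ (α / 3) := by
    rw [← sq_abs, ← Real.rpow_natCast, ← Real.rpow_mul (abs_nonneg _)]
    congr 1
    push_cast
    ring
  rwa [h3] at h2

lemma tendsto_regPowDeriv (α : ℝ) (x : E2) :
    Filter.Tendsto (fun n : ℕ => regPowDeriv α (1 / ((n : ℝ) + 1)) x) Filter.atTop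
      (nhds (wGrad α x 0)) := by
  rcases eq_or_ne (x 0) 0 with h0 | h0
  · simp [regPowDeriv, h0, wGrad_apply_zero]
  have h : Filter.Tendsto (fun n : ℕ => x 0 ^ 2 + (1 / ((n : ℝ) + 1)) ^ 2) Filter.atTop
      (nhds (x 0 ^ 2)) := by
    simpa using (tendsto_one_div_add_atTop_nhds_zero_nat (𝕜 := ℝ)).pow 2 |>.const_add (x 0 ^ 2)
  have h2 := ((h.rpow_const (p := α / 6 - 1) (Or.inl (by positivity))).const_mul (x 0)).const_mul
    ((α / 3) * ((4 : ℝ) / 3) ^ α)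
  have hx : 0 < |x 0| := abs_pos.2 h0
  have h3 : x 0 * (x 0 ^ 2) ^ (α / 6 - 1) = |x 0| ^ ((α - 3) / 3) * Real.sign (x 0) := by
    have hs : x 0 = Real.sign (x 0) * |x 0| := by
      rcases lt_or_gt_of_ne h0 with h | h
      · rw [Real.sign_of_neg h, abs_of_neg h]
        ring
      · rw [Real.sign_of_pos h, abs_of_pos h, one_mul]
    have he : (α - 3) / 3 = 1 + 2 * (α / 6 - 1) := by ring
    rw [← sq_abs (x 0), ← Real.rpow_natCast, ← Real.rpow_mul hx.le, he, Real.rpow_add hx,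
      Real.rpow_one]
    nth_rewrite 1 [hs]
    push_cast
    ring
  rw [h3, ← mul_assoc, ← wGrad_apply_zero] at h2
  exact h2

lemma continuous_absPow {α : ℝ} (hα0 : 0 < α) :
    Continuous (fun x : E2 => ((4 : ℝ) / 3) ^ α * |x 0| ^ (α / 3)) :=
  continuous_const.mul (Continuous.rpow_const (by fun_prop) fun _ => Or.inr (by positivity))

lemma wGrad_apply (α : ℝ) (x : E2) (i : Fin 2) :
    wGrad α x i = wGrad α x 0 * (EuclideanSpace.single i (1 : ℝ) : E2) 0 := by
  fin_cases i <;> simp [wGrad_apply_one]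

lemma integrable_wGrad_apply_zero_mul {α : ℝ} (hα0 : 0 < α) {φ : E2 → ℝ} (hφ : Continuous φ)
    (hc : HasCompactSupport φ) : Integrable (fun x => wGrad α x 0 * φ x) := by
  simpa [mul_comm] using
    (locallyIntegrable_wGrad_apply_zero hα0).integrable_smul_left_of_hasCompactSupport hφ hc

lemma integral_regPow_mul_pd {α ε : ℝ} (hε : 0 < ε) {φ : E2 → ℝ} (hφ : ContDiff ℝ 1 φ)
    (hc : HasCompactSupport φ) (i : Fin 2) :
    ∫ x, regPow α ε x * pd i φ x =
      -∫ x, regPowDeriv α ε x * (EuclideanSpace.single i (1 : ℝ) : E2) 0 * φ x := by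
  have hfd (x : E2) : fderiv ℝ (regPow α ε) x (EuclideanSpace.single i 1) =
      regPowDeriv α ε x * (EuclideanSpace.single i (1 : ℝ) : E2) 0 := by
    rw [(hasFDerivAt_regPow hε x).fderiv]
    rfl
  have hpd : Continuous (pd i φ) := (hφ.continuous_fderiv one_ne_zero).clm_apply continuous_const
  have hpc : HasCompactSupport (pd i φ) := hc.fderiv_apply (𝕜 := ℝ) _
  have h := integral_mul_fderiv_eq_neg_fderiv_mul_of_integrable (μ := (volume : Measure E2))
    (f := regPow α ε) (g := φ) (v := EuclideanSpace.single i 1) ?_ ?_ ?_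
    (fun x _ => (hasFDerivAt_regPow hε x).differentiableAt)
    (fun x _ => (hφ.differentiable one_ne_zero) x)
  · simp only [hfd] at h
    exact h
  · simp only [hfd]
    exact (((continuous_regPowDeriv hε).mul continuous_const).mul
      hφ.continuous).integrable_of_hasCompactSupport hc.mul_left
  · exact ((continuous_regPow hε).mul hpd).integrable_of_hasCompactSupport hpc.mul_left
  · exact ((continuous_regPow hε).mul hφ.continuous).integrable_of_hasCompactSupport hc.mul_left

lemma regPow_nonneg (α ε : ℝ) (x : E2) : 0 ≤ regPow α ε x := by
  unfold regPow
  positivity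

lemma regPow_le_regPow {α ε δ : ℝ} (hα0 : 0 < α) (hε : 0 ≤ ε) (hεδ : ε ≤ δ) (x : E2) :
    regPow α ε x ≤ regPow α δ x := by
  unfold regPow
  gcongr

lemma integral_absPow_mul_pd {α : ℝ} (hα0 : 0 < α) (hα1 : α ≤ 3 / 2) {φ : E2 → ℝ}
    (hφ : ContDiff ℝ 1 φ) (hc : HasCompactSupport φ) (i : Fin 2) :
    ∫ x : E2, ((4 : ℝ) / 3) ^ α * |x 0| ^ (α / 3) * pd i φ x = -∫ x, wGrad α x i * φ x := by
  have hpd : Continuous (pd i φ) := (hφ.continuous_fderiv one_ne_zero).clm_apply continuous_const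
  have hpc : HasCompactSupport (pd i φ) := hc.fderiv_apply (𝕜 := ℝ) _
  have hpos (n : ℕ) : 0 < 1 / ((n : ℝ) + 1) := by positivity
  have hle (n : ℕ) : 1 / ((n : ℝ) + 1) ≤ 1 := by
    rw [div_le_one (by positivity)]
    linarith [n.cast_nonneg (α := ℝ)]
  have hsingle : |(EuclideanSpace.single i (1 : ℝ) : E2) 0| ≤ 1 := by
    fin_cases i <;> simp
  have hlim1 : Filter.Tendsto
      (fun n : ℕ => ∫ x, regPow α (1 / ((n : ℝ) + 1)) x * pd i φ x) Filter.atTop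
      (nhds (∫ x : E2, ((4 : ℝ) / 3) ^ α * |x 0| ^ (α / 3) * pd i φ x)) := by
    refine tendsto_integral_of_dominated_convergence (fun x => ‖regPow α 1 x * pd i φ x‖)
      (fun n => ((continuous_regPow (hpos n)).mul hpd).aestronglyMeasurable) ?_
      (fun n => Filter.Eventually.of_forall fun x => ?_)
      (Filter.Eventually.of_forall fun x => (tendsto_regPow hα0 x).mul_const _)
    · exact (((continuous_regPow one_pos).mul hpd).integrable_of_hasCompactSupport
        hpc.mul_left).norm
    · rw [norm_mul, norm_mul]
      refine mul_le_mul_of_nonneg_right ?_ (norm_nonneg _)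
      rw [Real.norm_of_nonneg (regPow_nonneg _ _ _), Real.norm_of_nonneg (regPow_nonneg _ _ _)]
      exact regPow_le_regPow hα0 (hpos n).le (hle n) x
  have hlim2 : Filter.Tendsto
      (fun n : ℕ => ∫ x, regPowDeriv α (1 / ((n : ℝ) + 1)) x *
        (EuclideanSpace.single i (1 : ℝ) : E2) 0 * φ x) Filter.atTop
      (nhds (∫ x, wGrad α x i * φ x)) := by
    refine tendsto_integral_of_dominated_convergence (fun x => ‖wGrad α x 0 * φ x‖)
      (fun n => (((continuous_regPowDeriv (hpos n)).mul continuous_const).mul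
        hφ.continuous).aestronglyMeasurable)
      (integrable_wGrad_apply_zero_mul hα0 hφ.continuous hc).norm
      (fun n => Filter.Eventually.of_forall fun x => ?_)
      (Filter.Eventually.of_forall fun x => ?_)
    · rw [norm_mul, norm_mul, norm_mul]
      refine mul_le_mul_of_nonneg_right ?_ (norm_nonneg _)
      exact (mul_le_of_le_one_right (norm_nonneg _) hsingle).trans (abs_regPowDeriv_le hα1 x)
    · rw [wGrad_apply]
      exact ((tendsto_regPowDeriv α x).mul_const _).mul_const _
  refine tendsto_nhds_unique hlim1 (hlim2.neg.congr fun n => ?_)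
  exact (integral_regPow_mul_pd (hpos n) hφ hc i).symm

lemma hasWeakGradOn_wGrad {α : ℝ} (hα0 : 0 < α) (hα1 : α ≤ 3 / 2) :
    HasWeakGradOn (fun x : E2 => ((4 : ℝ) / 3) ^ α * |x 0| ^ (α / 3)) (wGrad α) Set.univ := by
  refine ⟨(continuous_absPow hα0).locallyIntegrable.locallyIntegrableOn _, ?_,
    fun φ hφ hc _ i => ?_⟩
  · simp only [norm_wGrad]
    exact LocallyIntegrable.locallyIntegrableOn
      (fun x => (locallyIntegrable_wGrad_apply_zero hα0 x).norm) _
  · simp only [setIntegral_univ]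
    exact integral_absPow_mul_pd hα0 hα1 (hφ.of_le (by exact_mod_cast le_top)) hc i

/-- On `{x₁ > 0}` the first component of any weak gradient agrees with that of `wGrad α`. The
component is not assumed measurable: testing against positive functions forces integrability. -/
lemma ae_eq_wGrad_apply_zero {α : ℝ} (hα0 : 0 < α) (hα1 : α ≤ 3 / 2) {G : E2 → E2}
    (hG : HasWeakGradOn (fun x : E2 => ((4 : ℝ) / 3) ^ α * |x 0| ^ (α / 3)) G Set.univ) :
    ∀ᵐ x : E2, 0 < x 0 → G x 0 = wGrad α x 0 := by
  have hU : IsOpen {x : E2 | 0 < x 0} := isOpen_lt continuous_const (by fun_prop)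
  have hpair (φ : E2 → ℝ) (hφ : ContDiff ℝ (⊤ : ℕ∞) φ) (hc : HasCompactSupport φ) :
      ∫ x, G x 0 * φ x = ∫ x, wGrad α x 0 * φ x := by
    have h1 := hG.2.2 φ hφ hc (Set.subset_univ _) 0
    have h2 := (hasWeakGradOn_wGrad hα0 hα1).2.2 φ hφ hc (Set.subset_univ _) 0
    simp only [setIntegral_univ] at h1 h2
    linarith
  have hloc : LocallyIntegrableOn (fun x => G x 0) {x : E2 | 0 < x 0} := by
    intro x hx
    obtain ⟨r, hr, hball⟩ := Metric.nhds_basis_closedBall.mem_iff.1 (hU.mem_nhds hx)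
    let φ : ContDiffBump x := ⟨r / 2, r, by positivity, by linarith⟩
    have hpos : 0 < ∫ y, wGrad α y 0 * φ y := by
      rw [integral_pos_iff_support_of_nonneg]
      · refine (measure_ball_pos volume x hr).trans_le (measure_mono fun y hy => ?_)
        have hy0 : 0 < y 0 := hball (ball_subset_closedBall hy)
        have hφy : 0 < φ y := φ.pos_of_mem_ball hy
        rw [Function.mem_support, wGrad_apply_zero_of_pos α hy0]
        positivity
      · intro y
        by_cases hy : y ∈ ball x r
        · have hy0 : 0 < y 0 := hball (ball_subset_closedBall hy)
          simp only [Pi.zero_apply, wGrad_apply_zero_of_pos α hy0]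
          have := φ.nonneg (x := y)
          positivity
        · have : φ y = 0 := φ.zero_of_le_dist (by simpa using hy)
          simp [this]
      · exact integrable_wGrad_apply_zero_mul hα0 φ.continuous φ.hasCompactSupport
    have hGi : Integrable (fun y => G y 0 * φ y) := by
      by_contra hn
      have := hpair φ φ.contDiff φ.hasCompactSupport
      rw [integral_undef hn] at this
      exact hpos.ne this
    refine ⟨closedBall x (r / 2), mem_nhdsWithin_of_mem_nhds
      (closedBall_mem_nhds x (by positivity)), ?_⟩
    refine hGi.integrableOn.congr_fun (fun y hy => ?_) measurableSet_closedBall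
    simp [φ.one_of_mem_closedBall hy]
  have hw := (locallyIntegrable_wGrad_apply_zero hα0).locallyIntegrableOn {x : E2 | 0 < x 0}
  have h := hU.ae_eq_zero_of_integral_contDiff_smul_eq_zero (μ := volume) (hloc.sub hw)
    fun φ hφ hc hsub => ?_
  · filter_upwards [h] with x hx hx0
    exact sub_eq_zero.1 (hx hx0)
  · have h1 : Integrable (fun x => G x 0 * φ x) := by
      have hi : IntegrableOn (fun x => φ x * G x 0) (tsupport φ) :=
        (hloc.integrableOn_compact_subset hsub hc.isCompact).continuousOn_mul
          hφ.continuous.continuousOn hc.isCompact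
      have := (integrableOn_iff_integrable_of_support_subset
        ((Function.support_mul_subset_left _ _).trans (subset_tsupport φ))).1 hi
      simpa only [mul_comm] using this
    have h2 := integrable_wGrad_apply_zero_mul hα0 hφ.continuous hc
    calc ∫ x, φ x • ((fun x => G x 0) - fun x => wGrad α x 0) x
        = ∫ x, (G x 0 * φ x - wGrad α x 0 * φ x) := by
          congr with x
          simp only [Pi.sub_apply, smul_eq_mul]
          ring
      _ = 0 := by rw [integral_sub h1 h2, hpair φ hφ hc, sub_self]

lemma not_memW1pLoc_absPow {α : ℝ} (hα0 : 0 < α) (hα1 : α ≤ 3 / 2) :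
    ¬ MemW1pLoc (fun x : E2 => ((4 : ℝ) / 3) ^ α * |x 0| ^ (α / 3)) (3 / (3 - α)) Set.univ := by
  rintro ⟨G, hG, hGp⟩
  refine not_integrableOn_norm_wGrad_rpow hα0 hα1 ?_
  have hU : MeasurableSet {x : E2 | 0 < x 0} := measurableSet_lt measurable_const (by fun_prop)
  have h := (hGp (closedBall 0 1) (Set.subset_univ _) (isCompact_closedBall 0 1)).mono_set
    (Set.inter_subset_left.trans ball_subset_closedBall :
      ball (0 : E2) 1 ∩ {x | 0 < x 0} ⊆ closedBall 0 1)
  refine Integrable.mono h ?_ ?_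
  · simp only [norm_wGrad]
    exact ((measurable_wGrad_apply_zero α).abs.pow_const _).aestronglyMeasurable
  · filter_upwards [ae_restrict_of_ae (ae_eq_wGrad_apply_zero hα0 hα1 hG),
      ae_restrict_mem (measurableSet_ball.inter hU)] with x hx hxU
    rw [Real.norm_of_nonneg (by positivity), Real.norm_of_nonneg (by positivity), norm_wGrad,
      ← hx hxU.2]
    have hp : 0 ≤ 3 / (3 - α) := div_nonneg (by norm_num) (by linarith)
    exact Real.rpow_le_rpow (abs_nonneg _) (PiLp.norm_apply_le (G x) 0) hp

/-- For `w(x₁,x₂) = -|x₁|^{4/3}`, so `|Dw| = (4/3)|x₁|^{1/3}`, and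
`α ∈ (0,3/2]`: `|Dw|^α = (4/3)^α |x₁|^{α/3}` lies in `W^{1,1}_loc(ℝ²)` with weak
gradient `((α/3)(4/3)^α |x₁|^{(α-3)/3} sgn(x₁), 0)`, but this weak gradient is not in
`L^{3/(3-α)}(B(0,1))`; consequently `|Dw|^α ∉ W^{1,3/(3-α)}_loc(ℝ²)`. -/
theorem statement8 (α : ℝ) (hα0 : 0 < α) (hα1 : α ≤ 3 / 2) :
    HasWeakGradOn (fun x : E2 => ((4 : ℝ) / 3) ^ α * |x 0| ^ (α / 3))
      (wGrad α) Set.univ ∧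
    ¬ IntegrableOn (fun x : E2 => ‖wGrad α x‖ ^ (3 / (3 - α)))
        (ball (0 : E2) 1) volume ∧
    ¬ MemW1pLoc (fun x : E2 => ((4 : ℝ) / 3) ^ α * |x 0| ^ (α / 3))
        (3 / (3 - α)) Set.univ := by
  exact ⟨hasWeakGradOn_wGrad hα0 hα1,
    fun h => not_integrableOn_norm_wGrad_rpow hα0 hα1 (h.mono_set Set.inter_subset_left),
    not_memW1pLoc_absPow hα0 hα1⟩
end
end

section
/- For every α with 3/2 < α < 2 there is a constant C(α) with the following property. Let U ⊆ ℝ² be open and bounded, ε > 0, κ > 0, and let u ∈ C^∞(U), g ∈ C^∞(U) satisfy -Δ_∞u - εΔu = g pointwise in U. Then for every ξ ∈ C_c²(U): ∫_U |D²u Du|² (|Du|²+κ)^{α-2} ξ² dx + ε ∫_U (Δu)² (|Du|²+κ)^{α-2} ξ² dx ≤ C(α) ∫_U (|Du|²+κ)^{α} ( |Dξ|² + |D²ξ| |ξ| ) dx + C(α) | ∫_U ⟨Du, Dg⟩ (|Du|²+κ)^{α-2} ξ² dx | + C(α) ε ( ∫_U (Δu)² ξ² dx )^{1/2} ( κ^{2α-6}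 ∫_U g² ξ² dx + κ^{2α-5} ∫_U |D²u Du|² dx )^{1/2} + C(α) κ^{α-3/2} ∫_U ( |Dg| ξ² + |g| |Dξ| |ξ| ) dx. -/
open MeasureTheory Metric
open scoped ENNReal RealInnerProductSpace BigOperators

noncomputable section

theorem ContDiffOn.pd {U : Set E2} {f : E2 → ℝ} (hU : IsOpen U)
    (hf : ContDiffOn ℝ (⊤ : ℕ∞) f U) (i : Fin 2) : ContDiffOn ℝ (⊤ : ℕ∞) (pd i f) U :=
  (hf.fderiv_of_isOpen hU (by simp)).clm_apply contDiffOn_const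

theorem pd2_eq_fderiv_fderiv {f : E2 → ℝ} {x : E2} (hf : DifferentiableAt ℝ (fderiv ℝ f) x)
    (i j : Fin 2) : pd2 i j f x =
      fderiv ℝ (fderiv ℝ f) x (EuclideanSpace.single i 1) (EuclideanSpace.single j 1) := by
  unfold pd2 pd
  rw [fderiv_clm_apply hf (differentiableAt_const _)]
  simp

theorem pd2_comm {U : Set E2} {f : E2 → ℝ} (hU : IsOpen U)
    (hf : ContDiffOn ℝ (⊤ : ℕ∞) f U) {x : E2} (hx : x ∈ U) (i j : Fin 2) :
    pd2 i j f x = pd2 j i f x := by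
  have hd : DifferentiableAt ℝ (fderiv ℝ f) x :=
    ((hf.fderiv_of_isOpen hU (m := 1) (by norm_cast)).differentiableOn (by simp)).differentiableAt
      (hU.mem_nhds hx)
  rw [pd2_eq_fderiv_fderiv hd, pd2_eq_fderiv_fderiv hd]
  refine (hf.contDiffAt (hU.mem_nhds hx)).isSymmSndFDerivAt ?_ _ _
  rw [minSmoothness_of_isRCLikeNormedField]
  norm_cast

theorem DifferentiableAt.hasDerivAt_pd {f : E2 → ℝ} {x : E2} (hf : DifferentiableAt ℝ f x)
    (i : Fin 2) :
    HasDerivAt (fun r : ℝ => f (x + r • EuclideanSpace.single i (1 : ℝ))) (pd i f x) 0 :=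
  hf.hasFDerivAt.hasLineDerivAt _

theorem integrableOn_of_continuousOn_of_eq_zero {U K : Set E2} {f : E2 → ℝ}
    (hf : ContinuousOn f U) (hK : IsCompact K) (hKU : K ⊆ U) (h0 : ∀ x ∉ K, f x = 0) :
    IntegrableOn f U := by
  have h : Integrable f := (integrableOn_iff_integrable_of_support_subset
    (fun x hx => by_contra fun hxK => hx (h0 x hxK))).1 ((hf.mono hKU).integrableOn_compact hK)
  exact h.integrableOn

theorem integral_pd_eq_zero {U K : Set E2} {f : E2 → ℝ} (hU : IsOpen U)
    (hf : ContDiffOn ℝ 1 f U) (hK : IsCompact K) (hKU : K ⊆ U) (h0 : ∀ x ∉ K, f x = 0)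
    (i : Fin 2) : IntegrableOn (pd i f) U ∧ ∫ x in U, pd i f x = 0 := by
  have hloc : ∀ x ∉ K, f =ᶠ[nhds x] fun _ => 0 := fun x hx =>
    Filter.eventually_of_mem (hK.isClosed.isOpen_compl.mem_nhds hx) h0
  have hp0 : ∀ x ∉ K, pd i f x = 0 := fun x hx => by
    unfold pd; rw [(hloc x hx).fderiv_eq]; simp
  have hdiff : ∀ x, DifferentiableAt ℝ f x := fun x => by
    by_cases hx : x ∈ K
    · exact (hf.differentiableOn (by simp)).differentiableAt (hU.mem_nhds (hKU hx))
    · exact (hloc x hx).differentiableAt_iff.2 (differentiableAt_const _)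
  have hc : ContinuousOn (pd i f) U :=
    (hf.continuousOn_fderiv_of_isOpen hU le_rfl).clm_apply continuousOn_const
  have hint := integrableOn_of_continuousOn_of_eq_zero hc hK hKU hp0
  refine ⟨hint, ?_⟩
  have hfint := integrableOn_of_continuousOn_of_eq_zero hf.continuousOn hK hKU h0
  have hs : ∀ {g : E2 → ℝ}, (∀ x ∉ K, g x = 0) → IntegrableOn g U → Integrable g := fun hg hi =>
    (integrableOn_iff_integrable_of_support_subset
      (fun x hx => by_contra fun hxK => hx (hg x fun h => hxK (hKU h)))).1 hi
  have := integral_mul_fderiv_eq_neg_fderiv_mul_of_integrable (μ := volume)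
    (f := fun _ : E2 => (1 : ℝ)) (g := f) (v := EuclideanSpace.single i 1)
    (by simp) (by simp only [one_mul]; exact hs hp0 hint) (by simpa using hs h0 hfint)
    (fun x _ => differentiableAt_const _) (fun x _ => hdiff x)
  rw [setIntegral_eq_integral_of_forall_compl_eq_zero (fun x hx => hp0 x fun h => hx (hKU h))]
  simpa [pd] using this

theorem sum_sq_pd_le (f : E2 → ℝ) (x : E2) :
    pd 0 f x ^ 2 + pd 1 f x ^ 2 ≤ ‖fderiv ℝ f x‖ ^ 2 := by
  set S := pd 0 f x ^ 2 + pd 1 f x ^ 2 with hS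
  have hS0 : 0 ≤ S := by positivity
  have h := (fderiv ℝ f x).le_opNorm
    (pd 0 f x • EuclideanSpace.single 0 (1 : ℝ) + pd 1 f x • EuclideanSpace.single 1 (1 : ℝ))
  have hv : ‖pd 0 f x • EuclideanSpace.single (0 : Fin 2) (1 : ℝ)
      + pd 1 f x • EuclideanSpace.single 1 (1 : ℝ)‖ = √S := by
    rw [EuclideanSpace.norm_eq]; simp [Fin.sum_univ_two, hS]
  have e : fderiv ℝ f x (pd 0 f x • EuclideanSpace.single 0 (1 : ℝ)
      + pd 1 f x • EuclideanSpace.single 1 (1 : ℝ)) = S := by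
    rw [map_add, map_smul, map_smul]
    simp only [hS, smul_eq_mul, pd]; ring
  rw [e, hv, Real.norm_of_nonneg hS0] at h
  have hq := Real.sq_sqrt hS0
  rcases hS0.eq_or_lt with h0 | h0
  · rw [← h0]; positivity
  · have : √S ≤ ‖fderiv ℝ f x‖ := by
      refine le_of_mul_le_mul_right ?_ (Real.sqrt_pos.2 h0)
      rwa [← sq, hq]
    calc S = √S ^ 2 := hq.symm
      _ ≤ _ := by gcongr

theorem abs_hess_quadratic_le {f : E2 → ℝ} {x : E2} (hf : DifferentiableAt ℝ (fderiv ℝ f) x)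
    (p q : ℝ) :
    |p ^ 2 * pd2 0 0 f x + p * q * pd2 0 1 f x + p * q * pd2 1 0 f x + q ^ 2 * pd2 1 1 f x|
      ≤ ‖fderiv ℝ (fderiv ℝ f) x‖ * (p ^ 2 + q ^ 2) := by
  set v : E2 := p • EuclideanSpace.single 0 (1 : ℝ) + q • EuclideanSpace.single 1 (1 : ℝ) with hvd
  have hv : ‖v‖ = √(p ^ 2 + q ^ 2) := by
    rw [hvd, EuclideanSpace.norm_eq]; simp [Fin.sum_univ_two]
  have h := (fderiv ℝ (fderiv ℝ f) x).le_opNorm₂ v v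
  rw [hv, mul_assoc, Real.mul_self_sqrt (by positivity), Real.norm_eq_abs] at h
  convert h using 2
  simp only [pd2_eq_fderiv_fderiv hf, hvd, map_add, map_smul, add_apply,
    smul_apply, smul_eq_mul]
  ring

/-- One component of the vector field whose divergence carries the weighted Hessian estimate,
as a function of pointwise data: `(p, q)` is the gradient `Du` of the solution, `X` and `Y` are the
matching components of `D²u Du - Δu Du` and of `Du`, `z` is the cutoff with partial derivatives
`z1`, `z2`, and `g` is the right-hand side. -/
def flux (α κ p q X Y z z1 z2 g : ℝ) : ℝ :=
  z ^ 2 * ((p ^ 2 + q ^ 2) * (p ^ 2 + q ^ 2 + κ) ^ (α - 2)) * X / 2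
    + (p ^ 2 + q ^ 2) * (p ^ 2 + q ^ 2 + κ) ^ (α - 2) * z * (p * z1 + q * z2) * Y
    - g * (α * (p ^ 2 + q ^ 2 + κ) ^ (α - 2)
        + (2 - α) * κ * (p ^ 2 + q ^ 2 + κ) ^ (α - 3)) * z ^ 2 * Y

/-- Derivative of `flux` in terms of the derivatives of its arguments, where `T2`, `T3`, `T4` stand
for the powers of `p ^ 2 + q ^ 2 + κ` with exponents `α - 2`, `α - 3`, `α - 4`. -/
def fluxDeriv (α κ T2 T3 T4 p q X Y z z1 z2 g p' q' X' Y' z' z1' z2' g' : ℝ) : ℝ :=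
  let s := p ^ 2 + q ^ 2
  let s' := 2 * (p * p' + q * q')
  let G := α * T2 + (2 - α) * κ * T3
  let F' := s' * (T2 + (α - 2) * s * T3)
  let G' := (α - 2) * s' * (α * T3 + (3 - α) * κ * T4)
  z * z' * (s * T2) * X + z ^ 2 * F' * X / 2 + z ^ 2 * (s * T2) * X' / 2
    + F' * z * (p * z1 + q * z2) * Y + s * T2 * z' * (p * z1 + q * z2) * Y
    + s * T2 * z * (p' * z1 + p * z1' + q' * z2 + q * z2') * Y
    + s * T2 * z * (p * z1 + q * z2) * Y'
    - (g' * G * z ^ 2 * Y + g * G' * z ^ 2 * Y + 2 * g * G * z * z' * Y + g * G * z ^ 2 * Y')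

theorem hasDerivAt_flux {α κ : ℝ} (hκ : 0 < κ) {p q X Y z z1 z2 g : ℝ → ℝ}
    {p' q' X' Y' z' z1' z2' g' τ : ℝ}
    (hp : HasDerivAt p p' τ) (hq : HasDerivAt q q' τ) (hX : HasDerivAt X X' τ)
    (hY : HasDerivAt Y Y' τ) (hz : HasDerivAt z z' τ) (hz1 : HasDerivAt z1 z1' τ)
    (hz2 : HasDerivAt z2 z2' τ) (hg : HasDerivAt g g' τ) :
    HasDerivAt (fun r => flux α κ (p r) (q r) (X r) (Y r) (z r) (z1 r) (z2 r) (g r))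
      (fluxDeriv α κ ((p τ ^ 2 + q τ ^ 2 + κ) ^ (α - 2)) ((p τ ^ 2 + q τ ^ 2 + κ) ^ (α - 3))
        ((p τ ^ 2 + q τ ^ 2 + κ) ^ (α - 4)) (p τ) (q τ) (X τ) (Y τ) (z τ) (z1 τ) (z2 τ) (g τ)
        p' q' X' Y' z' z1' z2' g') τ := by
  have hs := (hp.pow 2).add (hq.pow 2)
  have ht := hs.add_const κ
  have h0 : p τ ^ 2 + q τ ^ 2 + κ ≠ 0 := by positivity
  have h2 := ht.rpow_const (p := α - 2) (Or.inl h0)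
  have h3 := ht.rpow_const (p := α - 3) (Or.inl h0)
  have hk := (hp.mul hz1).add (hq.mul hz2)
  have hF := hs.mul h2
  have hG := (h2.const_mul α).add (h3.const_mul ((2 - α) * κ))
  have := (((((hz.pow 2).mul hF).mul hX).div_const 2).add (((hF.mul hz).mul hk).mul hY)).sub
    (((hg.mul hG).mul (hz.pow 2)).mul hY)
  refine this.congr_deriv ?_
  simp only [Pi.add_apply, Pi.mul_apply, Pi.pow_apply, fluxDeriv,
    show α - 2 - 1 = α - 3 by ring, show α - 3 - 1 = α - 4 by ring]
  push_cast
  ring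

theorem two_mul_le_weighted {η x y : ℝ} (hη : 0 < η) : 2 * x * y ≤ η * x ^ 2 + y ^ 2 / η := by
  have h : 0 ≤ (η * x - y) ^ 2 / η := by positivity
  have e : (η * x - y) ^ 2 / η = η * x ^ 2 + y ^ 2 / η - 2 * x * y := by field_simp; ring
  linarith

theorem dot_sq_le (p q v w : ℝ) : (p * v + q * w) ^ 2 ≤ (p ^ 2 + q ^ 2) * (v ^ 2 + w ^ 2) := by
  nlinarith [sq_nonneg (p * w - q * v)]

theorem abs_dot_le {p q v w m n : ℝ} (hm : 0 ≤ m) (hn : 0 ≤ n) (h1 : p ^ 2 + q ^ 2 ≤ m ^ 2)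
    (h2 : v ^ 2 + w ^ 2 ≤ n ^ 2) : |p * v + q * w| ≤ m * n := by
  apply abs_le_of_sq_le_sq _ (by positivity)
  calc (p * v + q * w) ^ 2 ≤ (p ^ 2 + q ^ 2) * (v ^ 2 + w ^ 2) := dot_sq_le p q v w
    _ ≤ m ^ 2 * n ^ 2 := by gcongr
    _ = (m * n) ^ 2 := by ring

theorem flux_divergence_identity {α κ ε T4 p q a b c z z1 z2 g g1 g2 x11 x12 x21 x22 a2 b2 : ℝ}
    (hg : -((a * p + b * q) * p + (b * p + c * q) * q) - ε * (a + c) = g) :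
    let t := p ^ 2 + q ^ 2 + κ
    let T3 := t * T4
    let T2 := t * T3
    let F' := T2 - (2 - α) * (p ^ 2 + q ^ 2) * T3
    let G := α * T2 + (2 - α) * κ * T3
    let N := (a * p + b * q) * p + (b * p + c * q) * q
    let k := p * z1 + q * z2
    fluxDeriv α κ T2 T3 T4 p q (b * q - c * p) p z z1 z2 g
        a b (a2 * q + b * b - (b2 * p + c * a)) a z1 x11 x12 g1
      + fluxDeriv α κ T2 T3 T4 p q (b * p - a * q) q z z1 z2 g
        b c (b2 * p + b * b - (a2 * q + a * c)) c z2 x21 x22 g2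
    = z ^ 2 * G * ((a * p + b * q) ^ 2 + (b * p + c * q) ^ 2 + ε * (a + c) ^ 2)
      + 2 * ((p ^ 2 + q ^ 2) * T2) * z * ((a * p + b * q) * z1 + (b * p + c * q) * z2)
      + 2 * F' * N * z * k
      + (p ^ 2 + q ^ 2) * T2 * (z * (p ^ 2 * x11 + p * q * x12 + p * q * x21 + q ^ 2 * x22) + k ^ 2)
      - (p * g1 + q * g2) * G * z ^ 2
      + 2 * (2 - α) * (α * T3 + (3 - α) * κ * T4) * (g * N) * z ^ 2
      - 2 * g * G * z * k := by
  subst hg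
  simp only [fluxDeriv]
  ring

set_option maxHeartbeats 2000000 in
theorem flux_divergence_estimate
    {α κ ε T2 T3 T4 M3 M2 p q a b c z z1 z2 g g1 g2 x11 x12 x21 x22 a2 b2 d h : ℝ}
    (hα1 : 3 / 2 < α) (hα2 : α < 2) (hκ : 0 < κ) (hε : 0 < ε) (hT4 : 0 < T4)
    (hT3 : T3 = (p ^ 2 + q ^ 2 + κ) * T4) (hT2 : T2 = (p ^ 2 + q ^ 2 + κ) * T3)
    (hM3 : T3 ≤ M3) (hM2 : κ * T3 * √(p ^ 2 + q ^ 2) ≤ M2)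
    (hg : -((a * p + b * q) * p + (b * p + c * q) * q) - ε * (a + c) = g)
    (hd : z1 ^ 2 + z2 ^ 2 ≤ d ^ 2)
    (hh0 : 0 ≤ h) (hh : |p ^ 2 * x11 + p * q * x12 + p * q * x21 + q ^ 2 * x22|
      ≤ h * (p ^ 2 + q ^ 2)) :
    α * (2 * α - 3) / 2 * (T2 * z ^ 2 * ((a * p + b * q) ^ 2 + (b * p + c * q) ^ 2
        + ε * (a + c) ^ 2))
      ≤ fluxDeriv α κ T2 T3 T4 p q (b * q - c * p) p z z1 z2 g
          a b (a2 * q + b * b - (b2 * p + c * a)) a z1 x11 x12 g1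
        + fluxDeriv α κ T2 T3 T4 p q (b * p - a * q) q z z1 z2 g
          b c (b2 * p + b * b - (a2 * q + a * c)) c z2 x21 x22 g2
        + α * ((p * g1 + q * g2) * T2 * z ^ 2)
        + (36 / (α * (2 * α - 3)) + 1) *
          ((p ^ 2 + q ^ 2 + κ) ^ 2 * T2 * (d ^ 2 + h * |z|))
        + 4 * (M3 * ε * (|g| * |a + c| * z ^ 2))
        + M2 * (√(g1 ^ 2 + g2 ^ 2) * z ^ 2) := by
  have key := flux_divergence_identity (α := α) (κ := κ) (T4 := T4) (z := z) (z1 := z1) (z2 := z2)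
    (g1 := g1) (g2 := g2) (x11 := x11) (x12 := x12) (x21 := x21) (x22 := x22) (a2 := a2)
    (b2 := b2) hg
  simp only [← hT3, ← hT2] at key
  rw [key]
  clear key
  have hα3 : 0 ≤ 2 - α := by linarith
  have hα4 : 0 ≤ 3 - α := by linarith
  set s := p ^ 2 + q ^ 2 with hs
  have hs0 : 0 ≤ s := by positivity
  set t := s + κ with ht
  have ht0 : 0 < t := by positivity
  have hst : s ≤ t := by linarith
  have hκt : κ ≤ t := by linarith
  have hT30 : 0 < T3 := by rw [hT3]; positivity
  have hT20 : 0 < T2 := by rw [hT2]; positivity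
  set w1 := a * p + b * q with hw1
  set w2 := b * p + c * q with hw2
  set L := a + c with hL
  set N := w1 * p + w2 * q with hN
  set P := w1 ^ 2 + w2 ^ 2 with hP
  set k := p * z1 + q * z2 with hk
  set H := p ^ 2 * x11 + p * q * x12 + p * q * x21 + q ^ 2 * x22 with hH
  set e := p * g1 + q * g2 with he
  set G := α * T2 + (2 - α) * κ * T3 with hG
  set F' := T2 - (2 - α) * s * T3 with hF'
  set c0 := α * (2 * α - 3) with hc0
  have hc0p : 0 < c0 := by rw [hc0]; apply mul_pos <;> linarith
  set η := c0 / 6 with hη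
  have hηp : 0 < η := by positivity
  have hP0 : 0 ≤ P := by positivity
  have hNs : N ^ 2 ≤ s * P := by
    rw [hN, hP, hs, mul_comm w1, mul_comm w2]; exact dot_sq_le p q w1 w2
  have hks : k ^ 2 ≤ s * d ^ 2 := by
    exact (dot_sq_le p q z1 z2).trans (by gcongr)
  have hst2 : s ^ 2 ≤ t ^ 2 := by gcongr
  have h1 : -(2 * (s * T2) * z * (w1 * z1 + w2 * z2))
      ≤ η * (z ^ 2 * T2 * P) + T2 * t ^ 2 * d ^ 2 / η := by
    have i1 := two_mul_le_weighted (x := z * w1) (y := -(s * z1)) hηp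
    have i2 := two_mul_le_weighted (x := z * w2) (y := -(s * z2)) hηp
    have i3 : s ^ 2 * (z1 ^ 2 + z2 ^ 2) / η ≤ t ^ 2 * d ^ 2 / η := by gcongr
    calc _ = T2 * (2 * (z * w1) * (-(s * z1)) + 2 * (z * w2) * (-(s * z2))) := by ring
      _ ≤ T2 * (η * (z * w1) ^ 2 + (-(s * z1)) ^ 2 / η
            + (η * (z * w2) ^ 2 + (-(s * z2)) ^ 2 / η)) := by gcongr
      _ = T2 * (η * (z ^ 2 * P) + s ^ 2 * (z1 ^ 2 + z2 ^ 2) / η) := by rw [hP]; ring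
      _ ≤ T2 * (η * (z ^ 2 * P) + t ^ 2 * d ^ 2 / η) := by gcongr
      _ = _ := by ring
  have hsT : s * T3 ≤ T2 := by rw [hT2]; gcongr
  have hF'0 : 0 ≤ F' := by
    rw [hF']; linarith [mul_nonneg (by linarith : 0 ≤ α - 1) (mul_nonneg hs0 hT30.le)]
  have hF'T : F' ≤ T2 := by
    rw [hF']; linarith [mul_nonneg (mul_nonneg hα3 hs0) hT30.le]
  have hNk : |N * k| ≤ s * (√P * |d|) := by
    apply abs_le_of_sq_le_sq _ (by positivity)
    calc (N * k) ^ 2 = N ^ 2 * k ^ 2 := by ring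
      _ ≤ (s * P) * (s * d ^ 2) := by gcongr
      _ = (s * (√P * |d|)) ^ 2 := by rw [mul_pow, mul_pow, Real.sq_sqrt hP0, sq_abs]; ring
  have h2 : -(2 * F' * N * z * k) ≤ η * (z ^ 2 * T2 * P) + T2 * t ^ 2 * d ^ 2 / η := by
    have i1 := two_mul_le_weighted (x := |z| * √P) (y := s * |d|) hηp
    rw [mul_pow, mul_pow, Real.sq_sqrt hP0, sq_abs, sq_abs] at i1
    calc _ ≤ |2 * F' * N * z * k| := neg_le_abs _
      _ = F' * (2 * |z| * |N * k|) := by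
        rw [show 2 * F' * N * z * k = F' * (2 * z * (N * k)) by ring, abs_mul, abs_mul, abs_mul,
          abs_of_nonneg hF'0, abs_of_pos (two_pos : (0 : ℝ) < 2)]
      _ ≤ T2 * (2 * |z| * (s * (√P * |d|))) := by gcongr
      _ = T2 * (2 * (|z| * √P) * (s * |d|)) := by ring
      _ ≤ T2 * (η * (z ^ 2 * P) + s ^ 2 * d ^ 2 / η) := by gcongr
      _ ≤ T2 * (η * (z ^ 2 * P) + t ^ 2 * d ^ 2 / η) := by gcongr
      _ = _ := by ring
  have h3 : -(s * T2 * (z * H + k ^ 2)) ≤ t ^ 2 * T2 * (d ^ 2 + h * |z|) := by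
    have hzH : -(z * H) ≤ |z| * (h * s) :=
      (neg_le_abs _).trans (by rw [abs_mul]; gcongr)
    have hsT2 : 0 ≤ s * T2 := by positivity
    calc _ = s * T2 * (-(z * H) - k ^ 2) := by ring
      _ ≤ s * T2 * (|z| * (h * s) + s * d ^ 2) := by
        gcongr; linarith [sq_nonneg k, mul_nonneg hs0 (sq_nonneg d)]
      _ = s ^ 2 * T2 * (d ^ 2 + h * |z|) := by ring
      _ ≤ _ := by
        have : 0 ≤ d ^ 2 + h * |z| := by positivity
        gcongr
  have h4 : e * G * z ^ 2 ≤ α * (e * T2 * z ^ 2) + M2 * (√(g1 ^ 2 + g2 ^ 2) * z ^ 2) := by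
    have he' : |e| ≤ √s * √(g1 ^ 2 + g2 ^ 2) :=
      abs_dot_le (Real.sqrt_nonneg _) (Real.sqrt_nonneg _) (Real.sq_sqrt hs0).ge
        (Real.sq_sqrt (by positivity)).ge
    have i1 : (2 - α) * (κ * T3 * e) ≤ M2 * √(g1 ^ 2 + g2 ^ 2) := by
      calc (2 - α) * (κ * T3 * e) ≤ |(2 - α) * (κ * T3 * e)| := le_abs_self _
        _ = (2 - α) * (κ * T3 * |e|) := by
          rw [abs_mul, abs_mul, abs_of_pos (by linarith : 0 < 2 - α),
            abs_of_pos (by positivity : 0 < κ * T3)]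
        _ ≤ 1 * (κ * T3 * |e|) := by gcongr; linarith
        _ ≤ 1 * (κ * T3 * (√s * √(g1 ^ 2 + g2 ^ 2))) := by gcongr
        _ = κ * T3 * √s * √(g1 ^ 2 + g2 ^ 2) := by ring
        _ ≤ _ := by gcongr
    calc e * G * z ^ 2 = α * (e * T2 * z ^ 2) + (2 - α) * (κ * T3 * e) * z ^ 2 := by
          rw [hG]; ring
      _ ≤ α * (e * T2 * z ^ 2) + M2 * √(g1 ^ 2 + g2 ^ 2) * z ^ 2 := by gcongr
      _ = _ := by ring
  have hgL : -(g * L) ≤ |g| * |L| := (neg_le_abs _).trans (abs_mul _ _).le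
  have hgN : g * N = -(N ^ 2) + ε * (g * L) + ε ^ 2 * L ^ 2 := by rw [← hg]; ring
  have hgg : g ^ 2 = N ^ 2 - 2 * ε * (g * L) - ε ^ 2 * L ^ 2 := by rw [← hg]; ring
  have hκT : κ * T3 ≤ T2 := by rw [hT2]; gcongr
  have hG0 : 0 ≤ G := by
    rw [hG]
    positivity
  have hG2 : G ≤ 2 * T2 := by
    rw [hG]; linarith [mul_le_mul_of_nonneg_left hκT hα3]
  have hggT : T3 * g ^ 2 ≤ T2 * P + 2 * (M3 * ε * (|g| * |L|)) := by
    calc T3 * g ^ 2 ≤ T3 * (s * P + 2 * ε * (|g| * |L|)) := by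
          gcongr
          linarith [hNs, mul_le_mul_of_nonneg_left hgL hε.le,
            mul_nonneg (sq_nonneg ε) (sq_nonneg L)]
      _ = s * T3 * P + 2 * (T3 * ε * (|g| * |L|)) := by ring
      _ ≤ _ := by gcongr
  have h5 : 2 * g * G * z * k
      ≤ η * (z ^ 2 * (T2 * P + 2 * (M3 * ε * (|g| * |L|)))) + 4 * (T2 * t ^ 2 * d ^ 2 / η) := by
    have i1 := two_mul_le_weighted (x := |g| * |z|) (y := 2 * t * |k|) hηp
    rw [mul_pow, mul_pow, sq_abs, sq_abs, sq_abs] at i1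
    have hks' : k ^ 2 ≤ t * d ^ 2 := hks.trans (by gcongr)
    calc 2 * g * G * z * k ≤ |2 * g * G * z * k| := le_abs_self _
      _ = G * (2 * |g| * |z| * |k|) := by
        simp only [abs_mul, abs_of_nonneg hG0, abs_of_pos (two_pos : (0 : ℝ) < 2)]; ring
      _ ≤ 2 * T2 * (2 * |g| * |z| * |k|) := by gcongr
      _ = T3 * (2 * (|g| * |z|) * (2 * t * |k|)) := by rw [hT2]; ring
      _ ≤ T3 * (η * (g ^ 2 * z ^ 2) + (2 * t) ^ 2 * k ^ 2 / η) := by gcongr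
      _ ≤ T3 * (η * (g ^ 2 * z ^ 2) + (2 * t) ^ 2 * (t * d ^ 2) / η) := by gcongr
      _ = η * (z ^ 2 * (T3 * g ^ 2)) + 4 * (T2 * t ^ 2 * d ^ 2 / η) := by rw [hT2]; ring
      _ ≤ _ := by gcongr
  set R := 2 * (2 - α) * (α * T3 + (3 - α) * κ * T4) with hR
  have hκT4 : κ * T4 ≤ T3 := by rw [hT3]; gcongr
  have hR0 : 0 ≤ R := by
    rw [hR]; positivity
  have hR3 : R ≤ 3 * T3 := by
    have i1 : α * T3 + (3 - α) * κ * T4 ≤ 3 * T3 := by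
      linarith [mul_le_mul_of_nonneg_left hκT4 hα4]
    calc R ≤ 2 * (2 - α) * (3 * T3) := by
          rw [hR]
          gcongr
      _ ≤ 1 * (3 * T3) := by gcongr; linarith
      _ = _ := by ring
  have hRs : R * s ≤ G - c0 * T2 := by
    have e1 : G - c0 * T2 - R * s = T4 * ((2 - α) * (4 * α - 5) * (κ * t)
        + 2 * (2 - α) * (3 - α) * κ ^ 2) := by
      rw [hG, hc0, hR, hT2, hT3, show s = t - κ by rw [ht]; ring]; ring
    have : 0 ≤ T4 * ((2 - α) * (4 * α - 5) * (κ * t) + 2 * (2 - α) * (3 - α) * κ ^ 2) := by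
      have : 0 ≤ 4 * α - 5 := by linarith
      positivity
    linarith
  have h6 : -(R * (g * N) * z ^ 2)
      ≤ z ^ 2 * ((G - c0 * T2) * P + 3 * (M3 * ε * (|g| * |L|))) := by
    have i1 : -(g * N) ≤ s * P + ε * (|g| * |L|) := by
      linarith [hNs, mul_le_mul_of_nonneg_left hgL hε.le, mul_nonneg (sq_nonneg ε) (sq_nonneg L)]
    calc -(R * (g * N) * z ^ 2) = z ^ 2 * (R * (-(g * N))) := by ring
      _ ≤ z ^ 2 * (R * (s * P + ε * (|g| * |L|))) := by gcongr
      _ = z ^ 2 * (R * s * P + R * ε * (|g| * |L|)) := by ring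
      _ ≤ z ^ 2 * ((G - c0 * T2) * P + 3 * M3 * ε * (|g| * |L|)) := by
        gcongr
        exact hR3.trans (by linarith)
      _ = _ := by ring
  have hGT : c0 / 2 * T2 ≤ G := by
    have : 0 ≤ (2 - α) * κ * T3 := by
      positivity
    have : 0 ≤ α * (5 - 2 * α) / 2 * T2 := by
      have : 0 ≤ 5 - 2 * α := by linarith
      positivity
    rw [hG, hc0]
    linarith
  have h7 : z ^ 2 * (c0 / 2 * T2) * (ε * L ^ 2) ≤ z ^ 2 * G * (ε * L ^ 2) := by gcongr
  have hA : 36 / c0 * (t ^ 2 * T2 * d ^ 2) ≤ 36 / c0 * (t ^ 2 * T2 * (d ^ 2 + h * |z|)) := by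
    have : d ^ 2 ≤ d ^ 2 + h * |z| := le_add_of_nonneg_right (by positivity)
    gcongr
  have hc2 : c0 ≤ 2 := by 
    calc c0 ≤ 2 * 1 := by rw [hc0]; gcongr <;> linarith
      _ = 2 := by norm_num
  have hB : 0 ≤ M3 * ε * (|g| * |L|) * z ^ 2 := by
    have : 0 ≤ M3 := hT30.le.trans hM3
    positivity
  have hB2 : 2 * η * (M3 * ε * (|g| * |L|) * z ^ 2) ≤ 1 * (M3 * ε * (|g| * |L|) * z ^ 2) := by
    gcongr
    linarith
  have hη' : T2 * t ^ 2 * d ^ 2 / η = 6 / c0 * (t ^ 2 * T2 * d ^ 2) := by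
    rw [hη]; field_simp
  rw [hη'] at h1 h2 h5
  have h3e : η * (z ^ 2 * T2 * P) = c0 / 6 * (z ^ 2 * T2 * P) := rfl
  rw [h3e] at h1 h2
  have h5e : η * (z ^ 2 * (T2 * P + 2 * (M3 * ε * (|g| * |L|))))
    = c0 / 6 * (z ^ 2 * T2 * P) + 2 * η * (M3 * ε * (|g| * |L|) * z ^ 2) := by rw [hη]; ring
  rw [h5e] at h5
  have hA' : 36 / c0 * (t ^ 2 * T2 * d ^ 2) = 6 * (6 / c0 * (t ^ 2 * T2 * d ^ 2)) := by ring
  linarith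

theorem pd_flux {α κ : ℝ} (hκ : 0 < κ) {p q X Y z z1 z2 g : E2 → ℝ} {x : E2}
    (hp : DifferentiableAt ℝ p x) (hq : DifferentiableAt ℝ q x) (hX : DifferentiableAt ℝ X x)
    (hY : DifferentiableAt ℝ Y x) (hz : DifferentiableAt ℝ z x) (hz1 : DifferentiableAt ℝ z1 x)
    (hz2 : DifferentiableAt ℝ z2 x) (hg : DifferentiableAt ℝ g x)
    (hV : DifferentiableAt ℝ
      (fun y => flux α κ (p y) (q y) (X y) (Y y) (z y) (z1 y) (z2 y) (g y)) x) (i : Fin 2) :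
    pd i (fun y => flux α κ (p y) (q y) (X y) (Y y) (z y) (z1 y) (z2 y) (g y)) x
      = fluxDeriv α κ ((p x ^ 2 + q x ^ 2 + κ) ^ (α - 2)) ((p x ^ 2 + q x ^ 2 + κ) ^ (α - 3))
        ((p x ^ 2 + q x ^ 2 + κ) ^ (α - 4)) (p x) (q x) (X x) (Y x) (z x) (z1 x) (z2 x) (g x)
        (pd i p x) (pd i q x) (pd i X x) (pd i Y x) (pd i z x) (pd i z1 x) (pd i z2 x)
        (pd i g x) := by
  have h := hasDerivAt_flux (α := α) hκ (hp.hasDerivAt_pd i) (hq.hasDerivAt_pd i)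
    (hX.hasDerivAt_pd i) (hY.hasDerivAt_pd i) (hz.hasDerivAt_pd i) (hz1.hasDerivAt_pd i)
    (hz2.hasDerivAt_pd i) (hg.hasDerivAt_pd i)
  simp only [zero_smul, add_zero] at h
  exact (hV.hasDerivAt_pd i).unique h

theorem contDiffOn_rpow_gradient {κ : ℝ} (hκ : 0 < κ) {U : Set E2} {p q : E2 → ℝ} {n : ℕ∞}
    (hp : ContDiffOn ℝ n p U) (hq : ContDiffOn ℝ n q U) (β : ℝ) :
    ContDiffOn ℝ n (fun y => (p y ^ 2 + q y ^ 2 + κ) ^ β) U :=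
  (((hp.pow 2).add (hq.pow 2)).add contDiffOn_const).rpow_const_of_ne
    fun x _ => by positivity

theorem contDiffOn_flux {α κ : ℝ} (hκ : 0 < κ) {U : Set E2} {p q X Y z z1 z2 g : E2 → ℝ}
    (hp : ContDiffOn ℝ 1 p U) (hq : ContDiffOn ℝ 1 q U) (hX : ContDiffOn ℝ 1 X U)
    (hY : ContDiffOn ℝ 1 Y U) (hz : ContDiffOn ℝ 1 z U) (hz1 : ContDiffOn ℝ 1 z1 U)
    (hz2 : ContDiffOn ℝ 1 z2 U) (hg : ContDiffOn ℝ 1 g U) :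
    ContDiffOn ℝ 1 (fun y => flux α κ (p y) (q y) (X y) (Y y) (z y) (z1 y) (z2 y) (g y)) U := by
  have h2 := contDiffOn_rpow_gradient (n := 1) hκ hp hq (α - 2)
  have h3 := contDiffOn_rpow_gradient (n := 1) hκ hp hq (α - 3)
  have hF := ((hp.pow 2).add (hq.pow 2)).mul h2
  exact (((((hz.pow 2).mul hF).mul hX).div_const 2).add
    (((hF.mul hz).mul ((hp.mul hz1).add (hq.mul hz2))).mul hY)).sub
    (((hg.mul ((contDiffOn_const.mul h2).add (contDiffOn_const.mul h3))).mul (hz.pow 2)).mul hY)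

theorem pd_mul_sub_mul {f g h k : E2 → ℝ} {x : E2} (hf : DifferentiableAt ℝ f x)
    (hg : DifferentiableAt ℝ g x) (hh : DifferentiableAt ℝ h x) (hk : DifferentiableAt ℝ k x)
    (i : Fin 2) : pd i (fun y => f y * g y - h y * k y) x
      = pd i f x * g x + f x * pd i g x - (pd i h x * k x + h x * pd i k x) := by
  have e := ((hf.hasDerivAt_pd i).mul (hg.hasDerivAt_pd i)).sub
    ((hh.hasDerivAt_pd i).mul (hk.hasDerivAt_pd i))
  simp only [zero_smul, add_zero] at e
  exact (((hf.mul hg).sub (hh.mul hk)).hasDerivAt_pd i).unique e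

theorem mul_rpow_mul_sqrt_le {α κ s : ℝ} (hα1 : 3 / 2 < α) (hα : α < 2) (hκ : 0 < κ) (hs : 0 ≤ s) :
    κ * (s + κ) ^ (α - 3) * √s ≤ κ ^ (α - 3 / 2) := by
  have ht : 0 < s + κ := by positivity
  calc κ * (s + κ) ^ (α - 3) * √s ≤ κ * (s + κ) ^ (α - 3) * √(s + κ) := by
        gcongr; linarith
    _ = κ * (s + κ) ^ (α - 5 / 2) := by
        rw [Real.sqrt_eq_rpow, mul_assoc, ← Real.rpow_add ht]; ring_nf
    _ ≤ κ * κ ^ (α - 5 / 2) := by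
        gcongr κ * ?_
        exact Real.rpow_le_rpow_of_nonpos hκ (by linarith) (by linarith)
    _ = κ ^ (α - 3 / 2) := by
        rw [← Real.rpow_one_add' hκ.le (by linarith)]; ring_nf

/-- The `i`-th component of the vector field built from `flux` for functions `u`, `g` and `ξ`. -/
def fluxField (α κ : ℝ) (u g ξ : E2 → ℝ) (i : Fin 2) (x : E2) : ℝ :=
  flux α κ (pd 0 u x) (pd 1 u x)
    (pd2 0 1 u x * pd (1 - i) u x - pd2 (1 - i) (1 - i) u x * pd i u x) (pd i u x)
    (ξ x) (pd 0 ξ x) (pd 1 ξ x) (g x)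

theorem contDiffOn_fluxField {α κ : ℝ} (hκ : 0 < κ) {U : Set E2} (hU : IsOpen U)
    {u g ξ : E2 → ℝ} (hu : ContDiffOn ℝ (⊤ : ℕ∞) u U) (hg : ContDiffOn ℝ (⊤ : ℕ∞) g U)
    (hξ : ContDiff ℝ 2 ξ) (i : Fin 2) : ContDiffOn ℝ 1 (fluxField α κ u g ξ i) U := by
  have h1 : ∀ {f : E2 → ℝ}, ContDiffOn ℝ (⊤ : ℕ∞) f U → ContDiffOn ℝ 1 f U :=
    fun hf => hf.of_le (by norm_cast)
  have hp : ∀ j, ContDiffOn ℝ 1 (pd j u) U := fun j => h1 (hu.pd hU j)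
  have hp2 : ∀ j k, ContDiffOn ℝ 1 (pd2 j k u) U := fun j k => h1 ((hu.pd hU k).pd hU j)
  have hξp : ∀ j, ContDiffOn ℝ 1 (pd j ξ) U := fun j =>
    ((hξ.fderiv_right (m := 1) (by norm_num)).clm_apply contDiff_const).contDiffOn
  exact contDiffOn_flux hκ (hp 0) (hp 1)
    (((hp2 0 1).mul (hp (1 - i))).sub ((hp2 (1 - i) (1 - i)).mul (hp i))) (hp i)
    (hξ.of_le (by norm_num)).contDiffOn (hξp 0) (hξp 1) (h1 hg)

theorem fluxField_estimate {α κ ε : ℝ} (hα1 : 3 / 2 < α) (hα2 : α < 2) (hκ : 0 < κ) (hε : 0 < ε)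
    {U : Set E2} (hU : IsOpen U)
    {u g ξ : E2 → ℝ} (hu : ContDiffOn ℝ (⊤ : ℕ∞) u U) (hg : ContDiffOn ℝ (⊤ : ℕ∞) g U)
    (hξ : ContDiff ℝ 2 ξ) {x : E2} (hx : x ∈ U) (heq : -infLap u x - ε * lap u x = g x) :
    α * (2 * α - 3) / 2 * (hessGradSq u x * (gradSq u x + κ) ^ (α - 2) * ξ x ^ 2
        + ε * ((lap u x) ^ 2 * (gradSq u x + κ) ^ (α - 2) * ξ x ^ 2))
      ≤ pd 0 (fluxField α κ u g ξ 0) x + pd 1 (fluxField α κ u g ξ 1) x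
        + α * ((∑ i : Fin 2, pd i u x * pd i g x) * (gradSq u x + κ) ^ (α - 2) * ξ x ^ 2)
        + (36 / (α * (2 * α - 3)) + 1) * ((gradSq u x + κ) ^ α *
            (‖fderiv ℝ ξ x‖ ^ 2 + ‖fderiv ℝ (fderiv ℝ ξ) x‖ * |ξ x|))
        + 4 * (κ ^ (α - 3) * ε * (|g x| * |lap u x| * ξ x ^ 2))
        + κ ^ (α - 3 / 2) * (Real.sqrt (gradSq g x) * ξ x ^ 2
            + |g x| * ‖fderiv ℝ ξ x‖ * |ξ x|) := by
  have hn := hU.mem_nhds hx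
  have hd : ∀ {f : E2 → ℝ}, ContDiffOn ℝ (⊤ : ℕ∞) f U → DifferentiableAt ℝ f x :=
    fun hf => (hf.differentiableOn (by simp)).differentiableAt hn
  have hp := fun j => hd (hu.pd hU j)
  have hp2 : ∀ j k, DifferentiableAt ℝ (pd2 j k u) x := fun j k => hd ((hu.pd hU k).pd hU j)
  have hξ1 : Differentiable ℝ ξ := hξ.differentiable (by norm_num)
  have hξ' : Differentiable ℝ (fderiv ℝ ξ) :=
    (hξ.fderiv_right (m := 1) (by norm_num)).differentiable (by norm_num)
  have hξp : ∀ j, DifferentiableAt ℝ (pd j ξ) x := fun j =>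
    (hξ' x).clm_apply (differentiableAt_const _)
  have hV : ∀ i, DifferentiableAt ℝ (fluxField α κ u g ξ i) x := fun i =>
    ((contDiffOn_fluxField hκ hU hu hg hξ i).differentiableOn (by norm_num)).differentiableAt hn
  have hX : ∀ i, DifferentiableAt ℝ
      (fun y => pd2 0 1 u y * pd (1 - i) u y - pd2 (1 - i) (1 - i) u y * pd i u y) x := fun i =>
    ((hp2 0 1).mul (hp (1 - i))).sub ((hp2 (1 - i) (1 - i)).mul (hp i))
  have e0 := pd_flux hκ (hp 0) (hp 1) (hX 0) (hp 0) (hξ1 x) (hξp 0) (hξp 1) (hd hg)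
    (hV 0) 0
  have e1 := pd_flux hκ (hp 0) (hp 1) (hX 1) (hp 1) (hξ1 x) (hξp 0) (hξp 1) (hd hg)
    (hV 1) 1
  change pd 0 (fluxField α κ u g ξ 0) x = _ at e0
  change pd 1 (fluxField α κ u g ξ 1) x = _ at e1
  rw [pd_mul_sub_mul (hp2 _ _) (hp _) (hp2 _ _) (hp _)] at e0 e1
  have hb : pd 1 (pd 0 u) x = pd2 0 1 u x := pd2_comm hU hu hx 1 0
  have hev : (pd2 0 1 u) =ᶠ[nhds x] (pd2 1 0 u) :=
    Filter.eventually_of_mem hn fun y hy => pd2_comm hU hu hy 0 1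
  have hab : pd 0 (pd2 0 1 u) x = pd 1 (pd2 0 0 u) x := by
    have : pd 0 (pd2 0 1 u) x = pd 0 (pd2 1 0 u) x := by unfold pd; rw [hev.fderiv_eq]
    rw [this]; exact pd2_comm hU (hu.pd hU 0) hx 0 1
  have hbc : pd 0 (pd2 1 1 u) x = pd 1 (pd2 0 1 u) x := pd2_comm hU (hu.pd hU 1) hx 0 1
  simp only [sub_zero, sub_self, hab, hbc, hb] at e0 e1
  have ha : pd 0 (pd 0 u) x = pd2 0 0 u x := rfl
  have hb' : pd 0 (pd 1 u) x = pd2 0 1 u x := rfl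
  have hc : pd 1 (pd 1 u) x = pd2 1 1 u x := rfl
  simp only [ha, hb', hc] at e0 e1
  have h10 : pd2 1 0 u x = pd2 0 1 u x := hb
  have hs0 : 0 < pd 0 u x ^ 2 + pd 1 u x ^ 2 + κ := by positivity
  have key := flux_divergence_estimate (T2 := (pd 0 u x ^ 2 + pd 1 u x ^ 2 + κ) ^ (α - 2))
    (T3 := (pd 0 u x ^ 2 + pd 1 u x ^ 2 + κ) ^ (α - 3))
    (T4 := (pd 0 u x ^ 2 + pd 1 u x ^ 2 + κ) ^ (α - 4)) (M3 := κ ^ (α - 3))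
    (M2 := κ ^ (α - 3 / 2)) (a := pd2 0 0 u x) (b := pd2 0 1 u x) (c := pd2 1 1 u x)
    (g := g x) (z := ξ x) (z1 := pd 0 ξ x) (z2 := pd 1 ξ x) (g1 := pd 0 g x) (g2 := pd 1 g x)
    (x11 := pd2 0 0 ξ x) (x12 := pd2 0 1 ξ x) (x21 := pd2 1 0 ξ x) (x22 := pd2 1 1 ξ x)
    (a2 := pd 1 (pd2 0 0 u) x) (b2 := pd 1 (pd2 0 1 u) x) (d := ‖fderiv ℝ ξ x‖)
    (h := ‖fderiv ℝ (fderiv ℝ ξ) x‖) hα1 hα2 hκ hε (by positivity)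
    (by rw [← Real.rpow_one_add' hs0.le (by linarith)]; ring_nf)
    (by rw [← Real.rpow_one_add' hs0.le (by linarith)]; ring_nf)
    (Real.rpow_le_rpow_of_nonpos hκ (le_add_of_nonneg_left (by positivity)) (by linarith))
    (mul_rpow_mul_sqrt_le hα1 hα2 hκ (by positivity))
    (by
      rw [← heq, infLap, lap]
      simp only [Fin.sum_univ_two, h10]
      ring)
    (sum_sq_pd_le ξ x) (norm_nonneg (fderiv ℝ (fderiv ℝ ξ) x)) (abs_hess_quadratic_le (hξ' x) _ _)
  have hpow : (pd 0 u x ^ 2 + pd 1 u x ^ 2 + κ) ^ 2 * (pd 0 u x ^ 2 + pd 1 u x ^ 2 + κ) ^ (α - 2)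
      = (pd 0 u x ^ 2 + pd 1 u x ^ 2 + κ) ^ α := by
    rw [← Real.rpow_natCast, ← Real.rpow_add hs0]; congr 1; push_cast; ring
  rw [hpow] at key
  have hextra : 0 ≤ κ ^ (α - 3 / 2) * (|g x| * ‖fderiv ℝ ξ x‖ * |ξ x|) := by positivity
  simp only [hessGradSq, gradSq, lap, Fin.sum_univ_two, h10]
  have r0 : pd2 0 0 ξ x = pd 0 (pd 0 ξ) x := rfl
  have r1 : pd2 0 1 ξ x = pd 0 (pd 1 ξ) x := rfl
  have r2 : pd2 1 0 ξ x = pd 1 (pd 0 ξ) x := rfl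
  have r3 : pd2 1 1 ξ x = pd 1 (pd 1 ξ) x := rfl
  rw [r0, r1, r2, r3, ← e0] at key
  rw [← e1] at key
  linarith

theorem integral_combination_le {U : Set E2} (hU : MeasurableSet U)
    {f₁ f₂ v₀ v₁ f₃ f₄ f₅ f₆ : E2 → ℝ} {c ε k₃ k₄ k₅ k₅' k₆ : ℝ}
    (h₁ : IntegrableOn f₁ U) (h₂ : IntegrableOn f₂ U) (hv₀ : IntegrableOn v₀ U)
    (hv₁ : IntegrableOn v₁ U) (h₃ : IntegrableOn f₃ U) (h₄ : IntegrableOn f₄ U)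
    (h₅ : IntegrableOn f₅ U) (h₆ : IntegrableOn f₆ U)
    (h : ∀ x ∈ U, c * (f₁ x + ε * f₂ x) ≤ v₀ x + v₁ x + k₃ * f₃ x + k₄ * f₄ x
      + k₅ * (k₅' * f₅ x) + k₆ * f₆ x) :
    c * ((∫ x in U, f₁ x) + ε * ∫ x in U, f₂ x)
      ≤ (∫ x in U, v₀ x) + (∫ x in U, v₁ x) + k₃ * (∫ x in U, f₃ x) + k₄ * (∫ x in U, f₄ x)
        + k₅ * (k₅' * ∫ x in U, f₅ x) + k₆ * ∫ x in U, f₆ x := by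
  have h₂' := h₂.const_mul ε
  have h₃' := h₃.const_mul k₃
  have h₄' := h₄.const_mul k₄
  have h₅' := (h₅.const_mul k₅').const_mul k₅
  have h₆' := h₆.const_mul k₆
  have s₁ := hv₀.add hv₁
  have s₂ := s₁.add h₃'
  have s₃ := s₂.add h₄'
  have s₄ := s₃.add h₅'
  have key : ∫ x in U, c * (f₁ x + ε * f₂ x) ≤ ∫ x in U, (v₀ x + v₁ x + k₃ * f₃ x + k₄ * f₄ x
      + k₅ * (k₅' * f₅ x) + k₆ * f₆ x) :=
    setIntegral_mono_on ((h₁.add h₂').const_mul c) (s₄.add h₆') hU h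
  have e₄ := integral_add s₄ h₆'
  have e₃ := integral_add s₃ h₅'
  have e₂ := integral_add s₂ h₄'
  have e₁ := integral_add s₁ h₃'
  simp only [Pi.add_apply] at e₁ e₂ e₃ e₄
  rw [integral_const_mul, integral_add h₁ h₂', integral_const_mul, e₄, e₃, e₂, e₁,
    integral_add hv₀ hv₁] at key
  simpa only [integral_const_mul] using key

theorem integral_weighted_estimate {α κ ε : ℝ} (hα1 : 3 / 2 < α) (hα2 : α < 2) (hκ : 0 < κ)
    (hε : 0 < ε) {U : Set E2} (hU : IsOpen U)
    {u g ξ : E2 → ℝ} (hu : ContDiffOn ℝ (⊤ : ℕ∞) u U) (hg : ContDiffOn ℝ (⊤ : ℕ∞) g U)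
    (hξ : ContDiff ℝ 2 ξ) (hξc : HasCompactSupport ξ) (hξU : tsupport ξ ⊆ U)
    (heq : ∀ x ∈ U, -infLap u x - ε * lap u x = g x) :
    (∫⁻ x in U, ENNReal.ofReal
          (hessGradSq u x * (gradSq u x + κ) ^ (α - 2) * ξ x ^ 2))
        + ENNReal.ofReal ε * ∫⁻ x in U, ENNReal.ofReal
            ((lap u x) ^ 2 * (gradSq u x + κ) ^ (α - 2) * ξ x ^ 2)
      ≤ ENNReal.ofReal (2 / (α * (2 * α - 3)) * (36 / (α * (2 * α - 3)) + 4)) *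
          (∫⁻ x in U, ENNReal.ofReal ((gradSq u x + κ) ^ α *
            (‖fderiv ℝ ξ x‖ ^ 2 + ‖fderiv ℝ (fderiv ℝ ξ) x‖ * |ξ x|)))
        + ENNReal.ofReal (2 / (α * (2 * α - 3)) * (36 / (α * (2 * α - 3)) + 4) *
            |∫ x in U, (∑ i : Fin 2, pd i u x * pd i g x) *
              (gradSq u x + κ) ^ (α - 2) * ξ x ^ 2|)
        + ENNReal.ofReal (2 / (α * (2 * α - 3)) * (36 / (α * (2 * α - 3)) + 4) * ε) *
            (ENNReal.ofReal (κ ^ (α - 3)) *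
              ∫⁻ x in U, ENNReal.ofReal (|g x| * |lap u x| * ξ x ^ 2))
        + ENNReal.ofReal (2 / (α * (2 * α - 3)) * (36 / (α * (2 * α - 3)) + 4)
              * κ ^ (α - 3 / 2)) *
            ∫⁻ x in U, ENNReal.ofReal (Real.sqrt (gradSq g x) * ξ x ^ 2
              + |g x| * ‖fderiv ℝ ξ x‖ * |ξ x|) := by
  have hc0 : 0 < α * (2 * α - 3) := by apply mul_pos <;> linarith
  set c0 := α * (2 * α - 3) with hc0d
  set C := 2 / c0 * (36 / c0 + 4) with hC
  have hC0 : 0 < C := by positivity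
  have hξ0 : ∀ x ∉ tsupport ξ, ξ x = 0 := fun x hx => image_eq_zero_of_notMem_tsupport hx
  have hdξ0 : ∀ x ∉ tsupport ξ, fderiv ℝ ξ x = 0 := fun x hx => fderiv_of_notMem_tsupport ℝ hx
  have hp : ∀ j, ContinuousOn (pd j u) U := fun j => (hu.pd hU j).continuousOn
  have hpg : ∀ j, ContinuousOn (pd j g) U := fun j => (hg.pd hU j).continuousOn
  have hp2 : ∀ j k, ContinuousOn (pd2 j k u) U := fun j k => ((hu.pd hU k).pd hU j).continuousOn
  have hξ' : ContDiff ℝ 1 (fderiv ℝ ξ) := hξ.fderiv_right (by norm_num)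
  have cξ : ContinuousOn ξ U := hξ.continuous.continuousOn
  have cg : ContinuousOn g U := hg.continuousOn
  have cdξ : ContinuousOn (fun x => ‖fderiv ℝ ξ x‖) U := hξ'.continuous.norm.continuousOn
  have cddξ : ContinuousOn (fun x => ‖fderiv ℝ (fderiv ℝ ξ) x‖) U :=
    (hξ'.continuous_fderiv (by norm_num)).norm.continuousOn
  have cs : ContinuousOn (gradSq u) U := continuousOn_finsetSum _ fun i _ => (hp i).pow 2
  have csg : ContinuousOn (gradSq g) U := continuousOn_finsetSum _ fun i _ => (hpg i).pow 2
  have cP : ContinuousOn (hessGradSq u) U := continuousOn_finsetSum _ fun i _ =>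
    (continuousOn_finsetSum _ fun j _ => (hp2 i j).mul (hp j)).pow 2
  have cL : ContinuousOn (lap u) U := (hp2 0 0).add (hp2 1 1)
  have hs0 : ∀ x, 0 ≤ gradSq u x := fun x => Finset.sum_nonneg fun i _ => sq_nonneg _
  have hP0 : ∀ x, 0 ≤ hessGradSq u x := fun x => Finset.sum_nonneg fun i _ => sq_nonneg _
  have ht0 : ∀ x, 0 < gradSq u x + κ := fun x => by have := hs0 x; positivity
  have cT : ∀ β : ℝ, ContinuousOn (fun x => (gradSq u x + κ) ^ β) U := fun β =>
    (cs.add continuousOn_const).rpow_const fun x _ => Or.inl (ht0 x).ne'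
  have int : ∀ {f : E2 → ℝ}, ContinuousOn f U → (∀ x ∉ tsupport ξ, f x = 0) → IntegrableOn f U :=
    fun hf h0 => integrableOn_of_continuousOn_of_eq_zero hf hξc hξU h0
  have i1 : IntegrableOn (fun x => hessGradSq u x * (gradSq u x + κ) ^ (α - 2) * ξ x ^ 2) U :=
    int ((cP.mul (cT (α - 2))).mul (cξ.pow 2)) fun x hx => by simp [hξ0 x hx]
  have i2 : IntegrableOn (fun x => (lap u x) ^ 2 * (gradSq u x + κ) ^ (α - 2) * ξ x ^ 2) U :=
    int (((cL.pow 2).mul (cT (α - 2))).mul (cξ.pow 2)) fun x hx => by simp [hξ0 x hx]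
  have i3 : IntegrableOn (fun x => (gradSq u x + κ) ^ α *
      (‖fderiv ℝ ξ x‖ ^ 2 + ‖fderiv ℝ (fderiv ℝ ξ) x‖ * |ξ x|)) U :=
    int ((cT α).mul ((cdξ.pow 2).add (cddξ.mul cξ.abs))) fun x hx => by
    simp [hξ0 x hx, hdξ0 x hx]
  have i4 : IntegrableOn (fun x => (∑ i : Fin 2, pd i u x * pd i g x) * (gradSq u x + κ) ^ (α - 2) *
      ξ x ^ 2) U :=
    int (((continuousOn_finsetSum Finset.univ fun i _ => (hp i).mul (hpg i)).mul
    (cT (α - 2))).mul (cξ.pow 2)) fun x hx => by simp [hξ0 x hx]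
  have i5 : IntegrableOn (fun x => |g x| * |lap u x| * ξ x ^ 2) U :=
    int ((cg.abs.mul cL.abs).mul (cξ.pow 2)) fun x hx => by simp [hξ0 x hx]
  have i6 : IntegrableOn (fun x => Real.sqrt (gradSq g x) * ξ x ^ 2 +
      |g x| * ‖fderiv ℝ ξ x‖ * |ξ x|) U :=
    int ((csg.sqrt.mul (cξ.pow 2)).add ((cg.abs.mul cdξ).mul cξ.abs)) fun x hx => by
    simp [hξ0 x hx]
  have hV := fun i => integral_pd_eq_zero hU (contDiffOn_fluxField (α := α) hκ hU hu hg hξ i)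
    hξc hξU (fun x hx => by simp [fluxField, flux, hξ0 x hx]) i
  have n1 : ∀ x, 0 ≤ hessGradSq u x * (gradSq u x + κ) ^ (α - 2) * ξ x ^ 2 := fun x => by
    have := hP0 x; have := (ht0 x).le; positivity
  have n2 : ∀ x, 0 ≤ (lap u x) ^ 2 * (gradSq u x + κ) ^ (α - 2) * ξ x ^ 2 := fun x => by
    have := (ht0 x).le; positivity
  have n3 : ∀ x, 0 ≤ (gradSq u x + κ) ^ α *
      (‖fderiv ℝ ξ x‖ ^ 2 + ‖fderiv ℝ (fderiv ℝ ξ) x‖ * |ξ x|) := fun x => by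
    have := (ht0 x).le; positivity
  have n5 : ∀ x, 0 ≤ |g x| * |lap u x| * ξ x ^ 2 := fun x => by positivity
  have n6 : ∀ x, 0 ≤ Real.sqrt (gradSq g x) * ξ x ^ 2 + |g x| * ‖fderiv ℝ ξ x‖ * |ξ x| :=
    fun x => by positivity
  have hreal := integral_combination_le hU.measurableSet i1 i2 (hV 0).1 (hV 1).1 i4 i3 i5 i6
    (fun x hx => fluxField_estimate hα1 hα2 hκ hε hU hu hg hξ hx (heq x hx))
  rw [(hV 0).2, (hV 1).2] at hreal
  simp only [← ofReal_integral_eq_lintegral_ofReal i1 (ae_of_all _ n1),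
    ← ofReal_integral_eq_lintegral_ofReal i2 (ae_of_all _ n2),
    ← ofReal_integral_eq_lintegral_ofReal i3 (ae_of_all _ n3),
    ← ofReal_integral_eq_lintegral_ofReal i5 (ae_of_all _ n5),
    ← ofReal_integral_eq_lintegral_ofReal i6 (ae_of_all _ n6)]
  have a1 := setIntegral_nonneg (μ := volume) hU.measurableSet fun x _ => n1 x
  have a2 := setIntegral_nonneg (μ := volume) hU.measurableSet fun x _ => n2 x
  have a3 := setIntegral_nonneg (μ := volume) hU.measurableSet fun x _ => n3 x
  have a5 := setIntegral_nonneg (μ := volume) hU.measurableSet fun x _ => n5 x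
  have a6 := setIntegral_nonneg (μ := volume) hU.measurableSet fun x _ => n6 x
  set A1 := ∫ x in U, hessGradSq u x * (gradSq u x + κ) ^ (α - 2) * ξ x ^ 2
  set A2 := ∫ x in U, (lap u x) ^ 2 * (gradSq u x + κ) ^ (α - 2) * ξ x ^ 2
  set A3 := ∫ x in U, (gradSq u x + κ) ^ α *
    (‖fderiv ℝ ξ x‖ ^ 2 + ‖fderiv ℝ (fderiv ℝ ξ) x‖ * |ξ x|)
  set J := ∫ x in U, (∑ i : Fin 2, pd i u x * pd i g x) * (gradSq u x + κ) ^ (α - 2) * ξ x ^ 2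
  set A5 := ∫ x in U, |g x| * |lap u x| * ξ x ^ 2
  set A6 := ∫ x in U, Real.sqrt (gradSq g x) * ξ x ^ 2 + |g x| * ‖fderiv ℝ ξ x‖ * |ξ x|
  have m3 : 0 < κ ^ (α - 3) := by positivity
  have m2 : 0 < κ ^ (α - 3 / 2) := by positivity
  rw [← ENNReal.ofReal_mul hε.le, ← ENNReal.ofReal_mul hC0.le, ← ENNReal.ofReal_mul m3.le,
    ← ENNReal.ofReal_mul (by positivity), ← ENNReal.ofReal_mul (by positivity),
    ← ENNReal.ofReal_add a1 (by positivity), ← ENNReal.ofReal_add (by positivity) (by positivity),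
    ← ENNReal.ofReal_add (by positivity) (by positivity),
    ← ENNReal.ofReal_add (by positivity) (by positivity)]
  apply ENNReal.ofReal_le_ofReal
  have hK : 0 < 36 / c0 := by positivity
  have b4 : α * J ≤ (36 / c0 + 4) * |J| := by
    calc α * J ≤ α * |J| := by gcongr; exact le_abs_self J
      _ ≤ _ := by gcongr; linarith
  have b3 : (36 / c0 + 1) * A3 ≤ (36 / c0 + 4) * A3 := by gcongr; norm_num
  have b5 : 4 * (κ ^ (α - 3) * ε * A5) ≤ (36 / c0 + 4) * (κ ^ (α - 3) * ε * A5) := by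
    gcongr; linarith
  have b6 : 1 * (κ ^ (α - 3 / 2) * A6) ≤ (36 / c0 + 4) * (κ ^ (α - 3 / 2) * A6) := by
    gcongr; linarith
  have hfin : c0 / 2 * (A1 + ε * A2) ≤ (36 / c0 + 4) * (A3 + |J| + ε * (κ ^ (α - 3) * A5)
      + κ ^ (α - 3 / 2) * A6) := by linarith
  calc A1 + ε * A2 = 2 / c0 * (c0 / 2 * (A1 + ε * A2)) := by field_simp
    _ ≤ 2 / c0 * ((36 / c0 + 4) * (A3 + |J| + ε * (κ ^ (α - 3) * A5)
      + κ ^ (α - 3 / 2) * A6)) := by gcongr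
    _ = _ := by rw [hC]; ring

theorem lintegral_abs_mul_le {U : Set E2} (hU : IsOpen U) {f g z : E2 → ℝ}
    (hf : ContinuousOn f U) (hg : ContinuousOn g U) (hz : ContinuousOn z U) :
    ∫⁻ x in U, ENNReal.ofReal (|f x| * |g x| * z x ^ 2)
      ≤ (∫⁻ x in U, ENNReal.ofReal (g x ^ 2 * z x ^ 2)) ^ ((1 : ℝ) / 2) *
        (∫⁻ x in U, ENNReal.ofReal (f x ^ 2 * z x ^ 2)) ^ ((1 : ℝ) / 2) := by
  have hm : ∀ {k : E2 → ℝ}, ContinuousOn k U →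
      AEMeasurable (fun x => ENNReal.ofReal (|k x * z x|)) (volume.restrict U) := fun hk =>
    ((hk.mul hz).abs.aemeasurable hU.measurableSet).ennreal_ofReal
  have hsq : ∀ (k : E2 → ℝ) x, ENNReal.ofReal (|k x * z x|) ^ (2 : ℝ)
      = ENNReal.ofReal (k x ^ 2 * z x ^ 2) := fun k x => by
    rw [ENNReal.ofReal_rpow_of_nonneg (abs_nonneg _) (by norm_num), Real.rpow_two, sq_abs, mul_pow]
  have h := ENNReal.lintegral_mul_le_Lp_mul_Lq (volume.restrict U)
    Real.HolderConjugate.two_two (hm hg) (hm hf)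
  simp only [hsq] at h
  refine le_trans (le_of_eq ?_) h
  refine lintegral_congr fun x => ?_
  rw [Pi.mul_apply, ← ENNReal.ofReal_mul (abs_nonneg _), abs_mul, abs_mul, ← sq_abs (z x)]
  congr 1
  ring

/-- Uniform weighted `L²` Hessian estimate for the regularized
equation `-Δ_∞u - εΔu = g` with weight `(|Du|²+κ)^{α-2}`, `3/2 < α < 2`, `κ > 0`,
with `C = C(α)`; integrals are interpreted in `[0,∞]`. -/
theorem statement17 (α : ℝ) (hα1 : 3 / 2 < α) (hα2 : α < 2) :
    ∃ C : ℝ, 0 < C ∧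
      ∀ (U : Set E2), IsOpen U → Bornology.IsBounded U →
      ∀ ε κ : ℝ, 0 < ε → 0 < κ →
      ∀ u g : E2 → ℝ, ContDiffOn ℝ (⊤ : ℕ∞) u U → ContDiffOn ℝ (⊤ : ℕ∞) g U →
        (∀ x ∈ U, -infLap u x - ε * lap u x = g x) →
      ∀ ξ : E2 → ℝ, ContDiff ℝ 2 ξ → HasCompactSupport ξ → tsupport ξ ⊆ U →
        (∫⁻ x in U, ENNReal.ofReal
              (hessGradSq u x * (gradSq u x + κ) ^ (α - 2) * ξ x ^ 2))
            + ENNReal.ofReal ε * ∫⁻ x in U, ENNReal.ofReal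
                ((lap u x) ^ 2 * (gradSq u x + κ) ^ (α - 2) * ξ x ^ 2)
          ≤ ENNReal.ofReal C * (∫⁻ x in U, ENNReal.ofReal ((gradSq u x + κ) ^ α *
                (‖fderiv ℝ ξ x‖ ^ 2 + ‖fderiv ℝ (fderiv ℝ ξ) x‖ * |ξ x|)))
            + ENNReal.ofReal (C * |∫ x in U, (∑ i : Fin 2, pd i u x * pd i g x) *
                (gradSq u x + κ) ^ (α - 2) * ξ x ^ 2|)
            + ENNReal.ofReal (C * ε) *
                (∫⁻ x in U, ENNReal.ofReal ((lap u x) ^ 2 * ξ x ^ 2)) ^ ((1 : ℝ) / 2) *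
                (ENNReal.ofReal (κ ^ (2 * α - 6)) *
                    (∫⁻ x in U, ENNReal.ofReal (g x ^ 2 * ξ x ^ 2))
                  + ENNReal.ofReal (κ ^ (2 * α - 5)) *
                    (∫⁻ x in U, ENNReal.ofReal (hessGradSq u x))) ^ ((1 : ℝ) / 2)
            + ENNReal.ofReal (C * κ ^ (α - 3 / 2)) *
                ∫⁻ x in U, ENNReal.ofReal
                  (Real.sqrt (gradSq g x) * ξ x ^ 2
                    + |g x| * ‖fderiv ℝ ξ x‖ * |ξ x|) := by
  have hc0 : 0 < α * (2 * α - 3) := by apply mul_pos <;> linarith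
  refine ⟨2 / (α * (2 * α - 3)) * (36 / (α * (2 * α - 3)) + 4), by positivity, ?_⟩
  intro U hU _ ε κ hε hκ u g hu hg heq ξ hξ hξc hξU
  refine (integral_weighted_estimate hα1 hα2 hκ hε hU hu hg hξ hξc hξU heq).trans ?_
  gcongr ?_ + ?_ + ?_ + ?_
  · exact le_rfl
  · exact le_rfl
  · rw [mul_assoc (ENNReal.ofReal _)]
    gcongr ENNReal.ofReal _ * ?_
    have hcs := lintegral_abs_mul_le (g := lap u) hU hg.continuousOn
      (((hu.pd hU 0).pd hU 0).continuousOn.add ((hu.pd hU 1).pd hU 1).continuousOn)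
      hξ.continuous.continuousOn
    have hκ6 : ENNReal.ofReal (κ ^ (α - 3)) = ENNReal.ofReal (κ ^ (2 * α - 6)) ^ ((1 : ℝ) / 2) := by
      rw [ENNReal.ofReal_rpow_of_nonneg (by positivity) (by norm_num), ← Real.rpow_mul hκ.le]
      ring_nf
    calc _ ≤ ENNReal.ofReal (κ ^ (α - 3)) * _ := mul_le_mul_right hcs _
      _ = _ * (ENNReal.ofReal (κ ^ (2 * α - 6)) *
            ∫⁻ x in U, ENNReal.ofReal (g x ^ 2 * ξ x ^ 2)) ^ ((1 : ℝ) / 2) := by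
        rw [ENNReal.mul_rpow_of_nonneg _ _ (by norm_num), hκ6, mul_left_comm]
      _ ≤ _ := by
        gcongr
        exact le_self_add
  · exact le_rfl
end
end
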